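/- Let $f\in L_p(\mathbb{T})$, $1\le p<\infty$, $r,n\in\mathbb{N}$, and suppose the sampling operators $G_n$, $n\in\mathbb{N}$, satisfy conditions (c1), (c1'), (c2') for some $s\in\mathbb{N}$ with $s\le 2r$, and condition (c3). Then there exist positive constants $c,C$ independent of $f$ and $n$ such that $c\big(\|f-G_n(f)\|_p+n^{-s}\|(G_n(f))^{(s)}\|_p\big)\le\|f_{\gamma/n,\,r}-f\|_{\ell_p(X_n)}+\omega_s(f,1/n)_p\le C\big(\|f-G_n(f)\|_p+n^{-s}\|(G_n(f))^{(s)}\|_p\big)$. -/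

import Mathlib

open MeasureTheory Filter Finset

noncomputable def LpNorm (p : ℝ) (f : ℝ → ℝ) : ℝ :=
  (∫ x in (0:ℝ)..1, |f x| ^ p) ^ (1 / p)

def MemLpT (p : ℝ) (f : ℝ → ℝ) : Prop :=
  Function.Periodic f 1 ∧ Measurable f ∧
    IntervalIntegrable (fun x => |f x| ^ p) MeasureTheory.volume 0 1

noncomputable def Delta (r : ℕ) (h : ℝ) (f : ℝ → ℝ) (x : ℝ) : ℝ :=
  ∑ ν ∈ Finset.range (r + 1), ((-1 : ℝ) ^ ν * (r.choose ν : ℝ)) * f (x + ((r : ℝ) - (ν : ℝ)) * h)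

noncomputable def omegaMod (r : ℕ) (p : ℝ) (f : ℝ → ℝ) (δ : ℝ) : ℝ :=
  sSup {y | ∃ h : ℝ, 0 < h ∧ h < δ ∧ y = LpNorm p (Delta r h f)}

noncomputable def steklov (r : ℕ) (δ : ℝ) (f : ℝ → ℝ) (x : ℝ) : ℝ :=
  (-1 : ℝ) ^ (r + 1) * (((2 * r).choose r : ℝ))⁻¹ * (2 / δ) *
    ∫ t in (-(δ / 2))..(δ / 2),
      ∑ ν ∈ Finset.range r,
        (-1 : ℝ) ^ ν * (((2 * r).choose ν : ℝ)) * f (x + (((r : ℝ) - (ν : ℝ)) / (r : ℝ)) * t)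

noncomputable def ellp (p : ℝ) (n : ℕ) (x : ℕ → ℝ) (f : ℝ → ℝ) : ℝ :=
  ((1 / (n : ℝ)) * ∑ k ∈ Finset.range n, |f (x k)| ^ p) ^ (1 / p)

def SobolevW (s : ℕ) (g : ℝ → ℝ) : Prop :=
  Function.Periodic g 1 ∧ ContDiff ℝ (s : ℕ∞) g

noncomputable def localMod (r : ℕ) (f : ℝ → ℝ) (x δ : ℝ) : ℝ :=
  sSup {y | ∃ t h : ℝ, t ∈ Set.Icc (x - r * δ / 2) (x + r * δ / 2) ∧
    (t + r * h) ∈ Set.Icc (x - r * δ / 2) (x + r * δ / 2) ∧ y = |Delta r h f t|}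

noncomputable def tauMod (r : ℕ) (p : ℝ) (f : ℝ → ℝ) (δ : ℝ) : ℝ :=
  (∫ x in (0:ℝ)..1, localMod r f x δ ^ p) ^ (1 / p)

def IsTrigPoly (n : ℕ) (T : ℝ → ℝ) : Prop :=
  ∃ c : ℤ → ℂ, ∀ x : ℝ, (T x : ℂ) =
    ∑ ℓ ∈ Finset.Icc (-(n : ℤ)) (n : ℤ),
      c ℓ * Complex.exp (2 * Real.pi * Complex.I * (ℓ : ℂ) * (x : ℂ))

noncomputable def tildeE (n : ℕ) (p : ℝ) (f : ℝ → ℝ) : ℝ :=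
  sInf {y | ∃ Q q : ℝ → ℝ, IsTrigPoly n Q ∧ IsTrigPoly n q ∧
    (∀ x, q x ≤ f x ∧ f x ≤ Q x) ∧ y = LpNorm p (fun x => Q x - q x)}

noncomputable def dirichlet (n : ℕ) (x : ℝ) : ℝ :=
  ∑ ℓ ∈ Finset.Icc (-(n : ℤ)) (n : ℤ), Real.cos (2 * Real.pi * (ℓ : ℝ) * x)

noncomputable def lagrange (n : ℕ) (f : ℝ → ℝ) (x : ℝ) : ℝ :=
  (1 / (2 * (n : ℝ) + 1)) * ∑ k ∈ Finset.range (2 * n + 1),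
    f ((k : ℝ) / (2 * (n : ℝ) + 1)) * dirichlet n (x - (k : ℝ) / (2 * (n : ℝ) + 1))

def NodesOK (γ : ℝ) (X : ℕ → ℕ → ℝ) : Prop :=
  ∀ n : ℕ, 1 ≤ n →
    (0 ≤ X n 0) ∧ (∀ k, k + 1 < n → X n k < X n (k + 1)) ∧ (X n (n - 1) < 1) ∧
    (∀ k, k + 1 < n → γ / (n : ℝ) ≤ X n (k + 1) - X n k) ∧
    (γ / (n : ℝ) ≤ 1 + X n 0 - X n (n - 1))

def NodesOrd (X : ℕ → ℕ → ℝ) : Prop :=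
  ∀ n : ℕ, 1 ≤ n →
    (0 ≤ X n 0) ∧ (∀ k, k + 1 < n → X n k < X n (k + 1)) ∧ (X n (n - 1) < 1)

def SamplingForm (p : ℝ) (X : ℕ → ℕ → ℝ) (φ : ℕ → ℕ → ℝ → ℝ)
    (G : ℕ → (ℝ → ℝ) → ℝ → ℝ) : Prop :=
  (∀ n k, MemLpT p (φ n k)) ∧
  ∀ (n : ℕ) (f : ℝ → ℝ) (x : ℝ), G n f x = ∑ k ∈ Finset.range n, f (X n k) * φ n k x

def CondC1 (p K1 : ℝ) (X : ℕ → ℕ → ℝ) (G : ℕ → (ℝ → ℝ) → ℝ → ℝ) : Prop :=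
  ∀ f : ℝ → ℝ, MemLpT p f → ∀ n : ℕ, 1 ≤ n → LpNorm p (G n f) ≤ K1 * ellp p n (X n) f

def CondC1' (p K2 : ℝ) (X : ℕ → ℕ → ℝ) (G : ℕ → (ℝ → ℝ) → ℝ → ℝ) : Prop :=
  ∀ f : ℝ → ℝ, MemLpT p f → ∀ n : ℕ, 1 ≤ n → K2 * ellp p n (X n) f ≤ LpNorm p (G n f)

def CondC2' (p K3 : ℝ) (s : ℕ) (G : ℕ → (ℝ → ℝ) → ℝ → ℝ) : Prop :=
  ∀ g : ℝ → ℝ, SobolevW s g → ∀ n : ℕ, 1 ≤ n →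
    LpNorm p (fun x => g x - G n g x) ≤ K3 / (n : ℝ) ^ s * LpNorm p (iteratedDeriv s g)

def CondC3 (p K5 : ℝ) (s : ℕ) (G : ℕ → (ℝ → ℝ) → ℝ → ℝ) : Prop :=
  ∀ f : ℝ → ℝ, MemLpT p f → ∀ n : ℕ, 1 ≤ n →
    SobolevW s (G n f) ∧
    (1 / (n : ℝ) ^ s) * LpNorm p (iteratedDeriv s (G n f)) ≤
      K5 * omegaMod s p (G n f) (1 / (n : ℝ))

noncomputable def Gprev (G : ℕ → (ℝ → ℝ) → ℝ → ℝ) (f : ℝ → ℝ) (ν : ℕ) : ℝ → ℝ :=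
  if ν = 0 then fun _ => 0 else G (2 ^ (ν - 1)) f

def CondC4 (p K4 : ℝ) (s : ℕ) (G : ℕ → (ℝ → ℝ) → ℝ → ℝ) (f : ℝ → ℝ) : Prop :=
  ∀ ν : ℕ,
    SobolevW s (fun x => G (2 ^ ν) f x - Gprev G f ν x) ∧
    LpNorm p (iteratedDeriv s (fun x => G (2 ^ ν) f x - Gprev G f ν x)) ≤
      K4 * 2 ^ (s * ν) * LpNorm p (fun x => G (2 ^ ν) f x - Gprev G f ν x)

noncomputable def Kfun (s : ℕ) (p : ℝ) (n : ℕ) (x : ℕ → ℝ) (f : ℝ → ℝ) : ℝ :=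
  sInf {y | ∃ g : ℝ → ℝ, SobolevW s g ∧
    y = ellp p n x (fun t => f t - g t) + LpNorm p (fun t => f t - g t) +
        (1 / (n : ℝ) ^ s) * LpNorm p (iteratedDeriv s g)}


noncomputable abbrev nu0 : Measure ℝ := volume.restrict (Set.Ioc (0:ℝ) 1)

instance nu0_prob : IsProbabilityMeasure nu0 := ⟨by simp [nu0]⟩

noncomputable def NN (p : ℝ) (f : ℝ → ℝ) : ENNReal := eLpNorm f (ENNReal.ofReal p) nu0

lemma ofReal_ne_zero_of {p : ℝ} (hp : 1 ≤ p) : ENNReal.ofReal p ≠ 0 := by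
  simp; linarith

lemma one_le_ofReal_of {p : ℝ} (hp : 1 ≤ p) : 1 ≤ ENNReal.ofReal p := by
  simpa using ENNReal.ofReal_le_ofReal hp

lemma NN_eq {p : ℝ} (hp : 1 ≤ p) (f : ℝ → ℝ) :
    NN p f = (∫⁻ x in Set.Ioc (0:ℝ) 1, ‖f x‖ₑ ^ p) ^ (1 / p) := by
  rw [NN, eLpNorm_eq_lintegral_rpow_enorm_toReal (ofReal_ne_zero_of hp) ENNReal.ofReal_ne_top,
    ENNReal.toReal_ofReal (by linarith)]

lemma enorm_rpow_eq {p : ℝ} (hp : 1 ≤ p) (y : ℝ) : ENNReal.ofReal (|y| ^ p) = ‖y‖ₑ ^ p := by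
  rw [← ENNReal.ofReal_rpow_of_nonneg (abs_nonneg _) (by linarith), ← Real.norm_eq_abs,
    ofReal_norm]

lemma meas_abs_rpow {p : ℝ} {f : ℝ → ℝ} (hf : Measurable f) :
    Measurable (fun x => |f x| ^ p) :=
  (measurable_norm.comp hf).pow_const p

lemma LpNorm_eq {p : ℝ} (hp : 1 ≤ p) {f : ℝ → ℝ} (hf : Measurable f) :
    LpNorm p f = (NN p f).toReal := by
  rw [NN_eq hp, LpNorm, intervalIntegral.integral_of_le zero_le_one,
    integral_eq_lintegral_of_nonneg_ae (Eventually.of_forall fun x => by positivity)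
      (meas_abs_rpow hf).aestronglyMeasurable, ENNReal.toReal_rpow]
  simp_rw [enorm_rpow_eq hp]

lemma LpNorm_nonneg (p : ℝ) (f : ℝ → ℝ) : 0 ≤ LpNorm p f := by
  unfold LpNorm
  apply Real.rpow_nonneg
  exact intervalIntegral.integral_nonneg zero_le_one fun x _ => by positivity

lemma MemLpT_iff {p : ℝ} (hp : 1 ≤ p) {f : ℝ → ℝ} :
    MemLpT p f ↔ Function.Periodic f 1 ∧ Measurable f ∧ MemLp f (ENNReal.ofReal p) nu0 := by
  unfold MemLpT
  refine and_congr_right fun _ => and_congr_right fun hm => ?_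
  rw [intervalIntegrable_iff_integrableOn_Ioc_of_le zero_le_one]
  have := integrable_norm_rpow_iff (μ := nu0) (f := f) hm.aestronglyMeasurable
    (ofReal_ne_zero_of hp) ENNReal.ofReal_ne_top
  rw [ENNReal.toReal_ofReal (by linarith)] at this
  exact this

lemma MemLpT.memLp {p : ℝ} (hp : 1 ≤ p) {f : ℝ → ℝ} (hf : MemLpT p f) :
    MemLp f (ENNReal.ofReal p) nu0 := ((MemLpT_iff hp).1 hf).2.2

lemma MemLpT.NN_eq {p : ℝ} (hp : 1 ≤ p) {f : ℝ → ℝ} (hf : MemLpT p f) :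
    NN p f = ENNReal.ofReal (LpNorm p f) := by
  rw [LpNorm_eq hp hf.2.1, ENNReal.ofReal_toReal]
  exact (hf.memLp hp).2.ne

lemma MemLpT.add {p : ℝ} (hp : 1 ≤ p) {f g : ℝ → ℝ} (hf : MemLpT p f) (hg : MemLpT p g) :
    MemLpT p (fun x => f x + g x) := by
  rw [MemLpT_iff hp] at *
  exact ⟨hf.1.add hg.1, hf.2.1.add hg.2.1, hf.2.2.add hg.2.2⟩

lemma MemLpT.sub {p : ℝ} (hp : 1 ≤ p) {f g : ℝ → ℝ} (hf : MemLpT p f) (hg : MemLpT p g) :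
    MemLpT p (fun x => f x - g x) := by
  rw [MemLpT_iff hp] at *
  exact ⟨hf.1.sub hg.1, hf.2.1.sub hg.2.1, hf.2.2.sub hg.2.2⟩

lemma MemLpT.const_mul {p : ℝ} (hp : 1 ≤ p) {f : ℝ → ℝ} (c : ℝ) (hf : MemLpT p f) :
    MemLpT p (fun x => c * f x) := by
  rw [MemLpT_iff hp] at *
  exact ⟨fun x => by simp [hf.1 x], hf.2.1.const_mul c, hf.2.2.const_mul c⟩

lemma MemLpT.zero {p : ℝ} (hp : 1 ≤ p) : MemLpT p (fun _ => 0) := by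
  rw [MemLpT_iff hp]
  exact ⟨fun x => rfl, measurable_const, MemLp.zero'⟩

lemma MemLpT.sum {p : ℝ} (hp : 1 ≤ p) {ι : Type*} (S : Finset ι) {F : ι → ℝ → ℝ}
    (h : ∀ i ∈ S, MemLpT p (F i)) : MemLpT p (fun x => ∑ i ∈ S, F i x) := by
  classical
  induction S using Finset.induction_on with
  | empty => simpa using MemLpT.zero hp
  | insert a S ha ih =>
    simp_rw [Finset.sum_insert ha]
    exact (h a (by simp)).add hp (ih fun i hi => h i (by simp [hi]))

lemma MemLpT.of_continuous {p : ℝ} (hp : 1 ≤ p) {f : ℝ → ℝ} (hper : Function.Periodic f 1)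
    (hf : Continuous f) : MemLpT p f := by
  refine ⟨hper, hf.measurable, ?_⟩
  exact (hf.abs.rpow_const fun x => Or.inr (by linarith)).intervalIntegrable _ _

lemma MemLpT.abs {p : ℝ} {f : ℝ → ℝ} (hf : MemLpT p f) : MemLpT p (fun x => |f x|) := by
  refine ⟨fun x => by simp [hf.1 x], measurable_norm.comp hf.2.1, ?_⟩
  simpa using hf.2.2

lemma LpNorm_abs {p : ℝ} {f : ℝ → ℝ} : LpNorm p (fun x => |f x|) = LpNorm p f := by
  simp [LpNorm]

lemma MemLpT.shift {p : ℝ} (hp : 1 ≤ p) {f : ℝ → ℝ} (a : ℝ) (hf : MemLpT p f) :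
    MemLpT p (fun x => f (x + a)) := by
  refine ⟨fun x => by show f (x + 1 + a) = f (x + a); rw [add_right_comm, hf.1], hf.2.1.comp (measurable_add_const a), ?_⟩
  have hper : Function.Periodic (fun x => |f x| ^ p) 1 := fun x => by simp [hf.1 x]
  have := hper.intervalIntegrable (t := 0) one_ne_zero (by simpa using hf.2.2) a (a + 1)
  have := this.comp_add_right a
  simpa using this

lemma LpNorm_shift {p : ℝ} {f : ℝ → ℝ} (a : ℝ) (hper : Function.Periodic f 1) :
    LpNorm p (fun x => f (x + a)) = LpNorm p f := by
  unfold LpNorm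
  have h2 : Function.Periodic (fun x => |f x| ^ p) 1 := fun x => by simp [hper x]
  rw [intervalIntegral.integral_comp_add_right (fun x => |f x| ^ p) a]
  have := h2.intervalIntegral_add_eq a 0
  rw [zero_add] at *
  rw [add_comm 1 a, this]

lemma LpNorm_add_le {p : ℝ} (hp : 1 ≤ p) {f g : ℝ → ℝ} (hf : MemLpT p f) (hg : MemLpT p g) :
    LpNorm p (fun x => f x + g x) ≤ LpNorm p f + LpNorm p g := by
  rw [LpNorm_eq hp hf.2.1, LpNorm_eq hp hg.2.1, LpNorm_eq hp (f := fun x => f x + g x) (hf.2.1.add hg.2.1),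
    NN, NN, NN, ← ENNReal.toReal_add (hf.memLp hp).2.ne (hg.memLp hp).2.ne]
  refine ENNReal.toReal_mono (ENNReal.add_ne_top.2 ⟨(hf.memLp hp).2.ne, (hg.memLp hp).2.ne⟩) ?_
  exact eLpNorm_add_le hf.2.1.aestronglyMeasurable hg.2.1.aestronglyMeasurable
    (one_le_ofReal_of hp)

lemma LpNorm_const_mul {p : ℝ} (hp : 1 ≤ p) {f : ℝ → ℝ} (c : ℝ) (hf : MemLpT p f) :
    LpNorm p (fun x => c * f x) = |c| * LpNorm p f := by
  rw [LpNorm_eq hp hf.2.1, LpNorm_eq hp (hf.2.1.const_mul c)]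
  have := eLpNorm_const_smul c f (ENNReal.ofReal p) nu0
  unfold NN
  have h2 : (fun x => c * f x) = c • f := rfl
  rw [h2, this, ENNReal.toReal_mul]
  simp

lemma LpNorm_sub_le {p : ℝ} (hp : 1 ≤ p) {f g : ℝ → ℝ} (hf : MemLpT p f) (hg : MemLpT p g) :
    LpNorm p (fun x => f x - g x) ≤ LpNorm p f + LpNorm p g := by
  have h := LpNorm_add_le hp hf (hg.const_mul hp (-1))
  rw [LpNorm_const_mul hp _ hg] at h
  simpa [sub_eq_add_neg] using h

lemma LpNorm_zero {p : ℝ} (hp : 1 ≤ p) : LpNorm p (fun _ => 0) = 0 := by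
  have := LpNorm_const_mul hp 0 (MemLpT.zero hp)
  simpa using this

lemma LpNorm_sum_le {p : ℝ} (hp : 1 ≤ p) {ι : Type*} (S : Finset ι) {F : ι → ℝ → ℝ}
    (h : ∀ i ∈ S, MemLpT p (F i)) :
    LpNorm p (fun x => ∑ i ∈ S, F i x) ≤ ∑ i ∈ S, LpNorm p (F i) := by
  classical
  induction S using Finset.induction_on with
  | empty => simp [LpNorm_zero hp]
  | insert a S ha ih =>
    simp_rw [Finset.sum_insert ha]
    have h1 := h a (by simp)
    have h2 : ∀ i ∈ S, MemLpT p (F i) := fun i hi => h i (by simp [hi])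
    exact (LpNorm_add_le hp h1 (MemLpT.sum hp S h2)).trans (by gcongr; exact ih h2)

lemma LpNorm_mono {p : ℝ} (hp : 1 ≤ p) {f g : ℝ → ℝ} (hf : MemLpT p f) (hg : MemLpT p g)
    (h : ∀ x, |f x| ≤ |g x|) : LpNorm p f ≤ LpNorm p g := by
  unfold LpNorm
  apply Real.rpow_le_rpow
  · exact intervalIntegral.integral_nonneg zero_le_one fun x _ => by positivity
  · apply intervalIntegral.integral_mono_on zero_le_one hf.2.2 hg.2.2
    intro x _
    exact Real.rpow_le_rpow (abs_nonneg _) (h x) (by linarith)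
  · positivity

/-- Minkowski / Jensen. -/
lemma NN_average_le {p : ℝ} (hp : 1 ≤ p) (μ : Measure ℝ) [IsProbabilityMeasure μ]
    {F : ℝ → ℝ → ℝ} (hF : Measurable (Function.uncurry F)) {M : ℝ}
    (hmem : ∀ u, MemLpT p (fun x => F x u))
    (hM : ∀ᵐ u ∂μ, LpNorm p (fun x => F x u) ≤ M) :
    NN p (fun x => ∫ u, F x u ∂μ) ≤ ENNReal.ofReal M := by
  have hp0 : 0 < p := by linarith
  rw [NN_eq hp, one_div, ENNReal.rpow_inv_le_iff hp0]
  have key : ∀ x, ‖∫ u, F x u ∂μ‖ₑ ^ p ≤ ∫⁻ u, ‖F x u‖ₑ ^ p ∂μ := by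
    intro x
    have hm : Measurable (F x) := hF.comp measurable_prodMk_left
    have h1 := enorm_integral_le_lintegral_enorm (μ := μ) (F x)
    have h2 := eLpNorm_le_eLpNorm_of_exponent_le (μ := μ) (one_le_ofReal_of hp)
      hm.aestronglyMeasurable
    rw [eLpNorm_one_eq_lintegral_enorm,
      eLpNorm_eq_lintegral_rpow_enorm_toReal (ofReal_ne_zero_of hp) ENNReal.ofReal_ne_top,
      ENNReal.toReal_ofReal hp0.le, one_div, ENNReal.le_rpow_inv_iff hp0] at h2
    exact (ENNReal.rpow_le_rpow h1 hp0.le).trans h2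
  have hmeas : Measurable (Function.uncurry fun x u => ‖F x u‖ₑ ^ p) :=
    (hF.enorm).pow_const p
  calc ∫⁻ x in Set.Ioc (0:ℝ) 1, ‖∫ u, F x u ∂μ‖ₑ ^ p
      ≤ ∫⁻ x in Set.Ioc (0:ℝ) 1, ∫⁻ u, ‖F x u‖ₑ ^ p ∂μ := lintegral_mono key
    _ = ∫⁻ u, (∫⁻ x in Set.Ioc (0:ℝ) 1, ‖F x u‖ₑ ^ p) ∂μ :=
        lintegral_lintegral_swap hmeas.aemeasurable
    _ ≤ ∫⁻ u, ENNReal.ofReal M ^ p ∂μ := by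
        apply lintegral_mono_ae
        filter_upwards [hM] with u hu
        have h3 := (hmem u).NN_eq hp
        rw [_root_.NN_eq hp, one_div] at h3
        rw [← ENNReal.rpow_inv_le_iff hp0, h3]
        exact ENNReal.ofReal_le_ofReal hu
    _ = ENNReal.ofReal M ^ p := by simp

lemma average_mem {p : ℝ} (hp : 1 ≤ p) (μ : Measure ℝ) [IsProbabilityMeasure μ]
    {F : ℝ → ℝ → ℝ} (hF : Measurable (Function.uncurry F)) {M : ℝ} (hM0 : 0 ≤ M)
    (hmem : ∀ u, MemLpT p (fun x => F x u))
    (hM : ∀ᵐ u ∂μ, LpNorm p (fun x => F x u) ≤ M) :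
    MemLpT p (fun x => ∫ u, F x u ∂μ) ∧ LpNorm p (fun x => ∫ u, F x u ∂μ) ≤ M := by
  have h := NN_average_le hp μ hF hmem hM
  have hme : Measurable (fun x => ∫ u, F x u ∂μ) :=
    (hF.stronglyMeasurable.integral_prod_right).measurable
  constructor
  · rw [MemLpT_iff hp]
    refine ⟨fun x => ?_, hme, hme.aestronglyMeasurable, h.trans_lt ENNReal.ofReal_lt_top⟩
    exact integral_congr_ae (Eventually.of_forall fun u => (hmem u).1 x)
  · rw [LpNorm_eq hp hme]
    exact ENNReal.toReal_le_of_le_ofReal hM0 h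

lemma MemLpT.locInt {p : ℝ} (hp : 1 ≤ p) {f : ℝ → ℝ} (hf : MemLpT p f) (a b : ℝ) :
    IntervalIntegrable f volume a b := by
  have h1 : Integrable f nu0 := (hf.memLp hp).integrable (one_le_ofReal_of hp)
  have h2 : IntervalIntegrable f volume 0 1 :=
    (intervalIntegrable_iff_integrableOn_Ioc_of_le zero_le_one).2 h1
  exact hf.1.intervalIntegrable (t := 0) one_ne_zero (by simpa using h2) a b

lemma Delta_mem {p : ℝ} (hp : 1 ≤ p) (s : ℕ) (h : ℝ) {f : ℝ → ℝ} (hf : MemLpT p f) :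
    MemLpT p (Delta s h f) :=
  MemLpT.sum hp _ fun ν _ => (hf.shift hp _).const_mul hp _

lemma Delta_norm_le {p : ℝ} (hp : 1 ≤ p) (s : ℕ) (h : ℝ) {f : ℝ → ℝ} (hf : MemLpT p f) :
    LpNorm p (Delta s h f) ≤ 2 ^ s * LpNorm p f := by
  refine (LpNorm_sum_le hp _ fun ν _ => (hf.shift hp _).const_mul hp _).trans ?_
  have : ∀ ν ∈ Finset.range (s + 1), LpNorm p (fun x => ((-1 : ℝ) ^ ν * (s.choose ν : ℝ)) *
      f (x + ((s : ℝ) - (ν : ℝ)) * h)) = (s.choose ν : ℝ) * LpNorm p f := by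
    intro ν _
    rw [LpNorm_const_mul hp _ (hf.shift hp _), LpNorm_shift _ hf.1]
    simp [abs_mul]
  rw [Finset.sum_congr rfl this, ← Finset.sum_mul]
  have h2 : (∑ i ∈ Finset.range (s + 1), (s.choose i : ℝ)) = 2 ^ s := by
    exact_mod_cast Nat.sum_range_choose s
  rw [h2]

lemma Delta_add (s : ℕ) (h : ℝ) (f g : ℝ → ℝ) (x : ℝ) :
    Delta s h (fun x => f x + g x) x = Delta s h f x + Delta s h g x := by
  simp [Delta, mul_add, Finset.sum_add_distrib]

lemma omega_bdd {p : ℝ} (hp : 1 ≤ p) (s : ℕ) (δ : ℝ) {f : ℝ → ℝ} (hf : MemLpT p f) :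
    BddAbove {y | ∃ h : ℝ, 0 < h ∧ h < δ ∧ y = LpNorm p (Delta s h f)} := by
  refine ⟨2 ^ s * LpNorm p f, ?_⟩
  rintro y ⟨h, -, -, rfl⟩
  exact Delta_norm_le hp s h hf

lemma le_omega {p : ℝ} (hp : 1 ≤ p) (s : ℕ) {h δ : ℝ} {f : ℝ → ℝ} (hf : MemLpT p f)
    (h0 : 0 < h) (h1 : h < δ) : LpNorm p (Delta s h f) ≤ omegaMod s p f δ :=
  le_csSup (omega_bdd hp s δ hf) ⟨h, h0, h1, rfl⟩

lemma omega_le {p : ℝ} (s : ℕ) {δ M : ℝ} {f : ℝ → ℝ} (hδ : 0 < δ)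
    (H : ∀ h, 0 < h → h < δ → LpNorm p (Delta s h f) ≤ M) : omegaMod s p f δ ≤ M := by
  refine csSup_le ⟨_, δ / 2, by linarith, by linarith, rfl⟩ ?_
  rintro y ⟨h, h0, h1, rfl⟩
  exact H h h0 h1

lemma omega_nonneg {p : ℝ} (s : ℕ) {δ : ℝ} (f : ℝ → ℝ) : 0 ≤ omegaMod s p f δ := by
  apply Real.sSup_nonneg
  rintro y ⟨h, h0, h1, rfl⟩
  exact LpNorm_nonneg _ _

lemma omega_le_add {p : ℝ} (hp : 1 ≤ p) (s : ℕ) {δ : ℝ} (hδ : 0 < δ) {f g : ℝ → ℝ}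
    (hf : MemLpT p f) (hg : MemLpT p g) :
    omegaMod s p f δ ≤ omegaMod s p g δ + 2 ^ s * LpNorm p (fun x => f x - g x) := by
  apply omega_le s hδ
  intro h h0 h1
  have e : Delta s h f = fun x => Delta s h g x + Delta s h (fun x => f x - g x) x := by
    funext x
    rw [← Delta_add]
    simp
  rw [e]
  refine (LpNorm_add_le hp (Delta_mem hp s h hg) (Delta_mem hp s h (hf.sub hp hg))).trans ?_
  gcongr
  · exact le_omega hp s hg h0 h1
  · exact Delta_norm_le hp s h (hf.sub hp hg)

lemma LpNorm_sub_comm {p : ℝ} (f g : ℝ → ℝ) :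
    LpNorm p (fun x => f x - g x) = LpNorm p (fun x => g x - f x) := by
  simp [LpNorm, abs_sub_comm]

lemma moments {N j : ℕ} (hj : j < N) (c : ℝ) :
    ∑ ν ∈ Finset.range (N + 1), ((-1 : ℝ) ^ ν * (N.choose ν : ℝ)) * (c + ((N:ℝ) - ν)) ^ j = 0 := by
  have h := congrFun (fwdDiff_iter_pow_eq_zero_of_lt (R := ℝ) hj) c
  rw [fwdDiff_iter_eq_sum_shift] at h
  rw [← Finset.sum_range_reflect] at h
  simp only [Pi.zero_apply] at h
  rw [← h]
  refine Finset.sum_congr rfl fun ν hν => ?_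
  have hν' : ν ≤ N := by simp at hν; omega
  have e1 : N + 1 - 1 - ν = N - ν := by omega
  rw [e1, Nat.sub_sub_self hν', Nat.choose_symm hν']
  simp [Nat.cast_sub hν']

lemma taylor_bound {s : ℕ} (hs : 1 ≤ s) {g : ℝ → ℝ} (hg : ContDiff ℝ (s : ℕ∞) g) (x : ℝ) :
    ∃ b : ℕ → ℝ, ∀ y d : ℝ, |y - x| ≤ d →
      |g y - ∑ j ∈ Finset.range s, b j * (y - x) ^ j| ≤
        d ^ (s - 1) * ∫ t in (x - d)..(x + d), |iteratedDeriv s g t| := by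
  obtain ⟨n, rfl⟩ : ∃ n, s = n + 1 := ⟨s - 1, by omega⟩
  refine ⟨fun j => (j.factorial : ℝ)⁻¹ * iteratedDeriv j g x, fun y d hd => ?_⟩
  have hd0 : 0 ≤ d := (abs_nonneg _).trans hd
  have hcont : Continuous (iteratedDeriv (n + 1) g) :=
    ContDiff.continuous_iteratedDeriv (n + 1) hg (by norm_cast)
  have hnn : 0 ≤ ∫ t in (x - d)..(x + d), |iteratedDeriv (n + 1) g t| :=
    intervalIntegral.integral_nonneg (by linarith) fun t _ => abs_nonneg _
  rcases eq_or_ne x y with rfl | hxy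
  · have : ∑ j ∈ Finset.range (n + 1), (j.factorial : ℝ)⁻¹ * iteratedDeriv j g x * (x - x) ^ j
        = g x := by
      rw [Finset.sum_range_succ']
      simp
    rw [this]
    simp only [sub_self, abs_zero]
    positivity
  have hu : UniqueDiffOn ℝ (Set.uIcc x y) := uniqueDiffOn_uIcc hxy
  have h := taylor_integral_remainder (f := g) (x := y) (x₀ := x) (n := n)
    (by exact_mod_cast hg.contDiffOn)
  rw [taylor_within_apply] at h
  have e1 : ∀ k ∈ Finset.range (n + 1), ((k.factorial : ℝ)⁻¹ * (y - x) ^ k) •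
      iteratedDerivWithin k g (Set.uIcc x y) x =
      (k.factorial : ℝ)⁻¹ * iteratedDeriv k g x * (y - x) ^ k := by
    intro k hk
    rw [iteratedDerivWithin_eq_iteratedDeriv hu _ Set.left_mem_uIcc]
    · simp; ring
    · refine (hg.of_le ?_).contDiffAt
      have hk' : k ≤ n + 1 := (Finset.mem_range.1 hk).le
      exact_mod_cast hk'
  rw [Finset.sum_congr rfl e1] at h
  rw [h]
  have e2 : ∫ t in x..y, ((y - t) ^ n / (n.factorial : ℝ)) •
      iteratedDerivWithin (n + 1) g (Set.uIcc x y) t =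
      ∫ t in x..y, ((y - t) ^ n / (n.factorial : ℝ)) * iteratedDeriv (n + 1) g t := by
    apply intervalIntegral.integral_congr
    intro t ht
    simp only [smul_eq_mul]
    rw [iteratedDerivWithin_eq_iteratedDeriv hu _ ht]
    exact_mod_cast hg.contDiffAt
  rw [e2, ← Real.norm_eq_abs]
  refine intervalIntegral.norm_integral_le_integral_norm_uIoc.trans ?_
  rw [← intervalIntegral.integral_const_mul, intervalIntegral.integral_of_le (by linarith)]
  have hsub : Set.uIoc x y ⊆ Set.Ioc (x - d) (x + d) := by
    rw [abs_le] at hd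
    apply Set.Ioc_subset_Ioc
    · exact le_min (by linarith) (by linarith)
    · exact max_le (by linarith) (by linarith)
  have hi : IntegrableOn (fun t => d ^ n * |iteratedDeriv (n + 1) g t|)
      (Set.Ioc (x - d) (x + d)) := by
    have : Continuous (fun t => d ^ n * |iteratedDeriv (n + 1) g t|) := by fun_prop
    exact this.integrableOn_Ioc
  refine le_trans ?_ (setIntegral_mono_set hi (Eventually.of_forall fun t => by
    show (0:ℝ) ≤ _
    positivity) hsub.eventuallyLE)
  apply setIntegral_mono_on
  · have : Continuous (fun t => ‖(y - t) ^ n / (n.factorial : ℝ) * iteratedDeriv (n + 1) g t‖) := by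
      fun_prop
    exact this.integrableOn_uIoc
  · exact hi.mono_set hsub
  · exact measurableSet_uIoc
  · intro t ht
    rw [norm_mul, Real.norm_eq_abs, Real.norm_eq_abs]
    have : |(y - t) ^ n / (n.factorial : ℝ)| ≤ d ^ n := by
      rw [abs_div, abs_pow]
      refine (div_le_self (by positivity) ?_).trans ?_
      · simp only [Nat.abs_cast]
        exact_mod_cast Nat.succ_le_of_lt n.factorial_pos
      · apply pow_le_pow_left₀ (abs_nonneg _)
        refine le_trans ?_ hd
        have := Set.uIoc_subset_uIcc ht
        rw [abs_sub_comm y t]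
        have h3 := Set.abs_sub_right_of_mem_uIcc this
        rw [abs_sub_comm y t] at h3
        exact h3
    rw [Nat.add_sub_cancel]
    gcongr

/-- finite functionals annihilating polynomials of degree less than `s`. -/
lemma functional_bound {s : ℕ} (hs : 1 ≤ s) {g : ℝ → ℝ} (hg : ContDiff ℝ (s : ℕ∞) g) (x d : ℝ)
    {ι : Type*} (S : Finset ι) (c a : ι → ℝ) (ha : ∀ i ∈ S, |a i| ≤ d)
    (hmom : ∀ j < s, ∑ i ∈ S, c i * a i ^ j = 0) :
    |∑ i ∈ S, c i * g (x + a i)| ≤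
      (∑ i ∈ S, |c i|) * (d ^ (s - 1) * ∫ t in (x - d)..(x + d), |iteratedDeriv s g t|) := by
  obtain ⟨b, hb⟩ := taylor_bound hs hg x
  have e : ∑ i ∈ S, c i * g (x + a i) =
      ∑ i ∈ S, c i * (g (x + a i) - ∑ j ∈ Finset.range s, b j * a i ^ j) := by
    simp_rw [mul_sub, Finset.sum_sub_distrib, Finset.mul_sum]
    rw [Finset.sum_comm (s := S)]
    have : ∑ y ∈ Finset.range s, ∑ i ∈ S, c i * (b y * a i ^ y) = 0 := by
      apply Finset.sum_eq_zero
      intro j hj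
      have := hmom j (by simpa using hj)
      calc ∑ i ∈ S, c i * (b j * a i ^ j) = b j * ∑ i ∈ S, c i * a i ^ j := by
            rw [Finset.mul_sum]; exact Finset.sum_congr rfl fun i _ => by ring
        _ = 0 := by rw [this, mul_zero]
    rw [this, sub_zero]
  rw [e, Finset.sum_mul]
  refine (Finset.abs_sum_le_sum_abs _ _).trans (Finset.sum_le_sum fun i hi => ?_)
  rw [abs_mul]
  have := hb (x + a i) d (by simpa using ha i hi)
  simp only [add_sub_cancel_left] at this
  gcongr

lemma iteratedDeriv_periodic {g : ℝ → ℝ} (hg : Function.Periodic g 1) (s : ℕ) :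
    Function.Periodic (iteratedDeriv s g) 1 := by
  intro x
  have h : (fun z => g (z + 1)) = g := funext hg
  have h2 := congrFun (iteratedDeriv_comp_add_const s g 1) x
  rw [h] at h2
  exact h2.symm

lemma SobolevW.deriv_cont {s : ℕ} {g : ℝ → ℝ} (hg : SobolevW s g) :
    Continuous (iteratedDeriv s g) :=
  ContDiff.continuous_iteratedDeriv s hg.2 (by norm_cast)

lemma SobolevW.deriv_mem {p : ℝ} (hp : 1 ≤ p) {s : ℕ} {g : ℝ → ℝ} (hg : SobolevW s g) :
    MemLpT p (iteratedDeriv s g) :=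
  MemLpT.of_continuous hp (iteratedDeriv_periodic hg.1 s) hg.deriv_cont

lemma SobolevW.mem {p : ℝ} (hp : 1 ≤ p) {s : ℕ} {g : ℝ → ℝ} (hg : SobolevW s g) :
    MemLpT p g :=
  MemLpT.of_continuous hp hg.1 hg.2.continuous

lemma window_avg {p : ℝ} (hp : 1 ≤ p) {v : ℝ → ℝ} (hv : MemLpT p v) (d : ℝ) (hd : 0 < d) :
    MemLpT p (fun x => ∫ u, |v (x + (-d + 2 * d * u))| ∂nu0) ∧
    LpNorm p (fun x => ∫ u, |v (x + (-d + 2 * d * u))| ∂nu0) ≤ LpNorm p v ∧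
    ∀ x, ∫ t in (x - d)..(x + d), |v t| =
      2 * d * ∫ u, |v (x + (-d + 2 * d * u))| ∂nu0 := by
  have h := average_mem hp nu0 (F := fun x u => |v (x + (-d + 2 * d * u))|) (M := LpNorm p v)
    (by
      have : Measurable (fun q : ℝ × ℝ => q.1 + (-d + 2 * d * q.2)) := by fun_prop
      exact measurable_norm.comp (hv.2.1.comp this))
    (LpNorm_nonneg _ _) (fun u => (hv.shift hp _).abs)
    (Eventually.of_forall fun u => by
      rw [LpNorm_abs (f := fun x => v (x + (-d + 2 * d * u))), LpNorm_shift _ hv.1])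
  refine ⟨h.1, h.2, fun x => ?_⟩
  have h2 := intervalIntegral.integral_comp_add_mul (a := 0) (b := 1) (fun t => |v t|)
    (c := 2 * d) (by positivity) (x - d)
  rw [intervalIntegral.integral_of_le zero_le_one] at h2
  have h3 : ∫ u, |v (x + (-d + 2 * d * u))| ∂nu0 = ∫ u, |v (x - d + 2 * d * u)| ∂nu0 := by
    congr 1; funext u; congr 2; ring
  rw [h3, h2, smul_eq_mul, ← mul_assoc, mul_inv_cancel₀ (by positivity), one_mul]
  congr 1 <;> ring

lemma sum_abs_choose (N : ℕ) :
    ∑ ν ∈ Finset.range (N + 1), |(-1 : ℝ) ^ ν * (N.choose ν : ℝ)| = 2 ^ N := by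
  simp only [abs_mul, abs_pow, abs_neg, abs_one, one_pow, one_mul, Nat.abs_cast]
  exact_mod_cast Nat.sum_range_choose N

lemma omega_smooth {p : ℝ} (hp : 1 ≤ p) {s : ℕ} (hs : 1 ≤ s) {g : ℝ → ℝ} (hg : SobolevW s g)
    {δ : ℝ} (hδ : 0 < δ) :
    omegaMod s p g δ ≤ (2 ^ (s + 1) * (s : ℝ) ^ s) * (δ ^ s * LpNorm p (iteratedDeriv s g)) := by
  apply omega_le s hδ
  intro h h0 h1
  have hsp : (0:ℝ) < s := by exact_mod_cast hs
  obtain ⟨w1, w2, w3⟩ := window_avg hp (hg.deriv_mem hp) (s * h) (by positivity)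
  set W : ℝ → ℝ := fun x => ∫ u, |iteratedDeriv s g (x + (-(s * h) + 2 * (s * h) * u))| ∂nu0
  have hb : ∀ x, |Delta s h g x| ≤ 2 ^ (s + 1) * (s * h) ^ s * W x := by
    intro x
    have := functional_bound hs hg.2 x (s * h) (Finset.range (s + 1))
      (fun ν => (-1 : ℝ) ^ ν * (s.choose ν : ℝ)) (fun ν => ((s:ℝ) - ν) * h) ?_ ?_
    · rw [sum_abs_choose, w3] at this
      refine this.trans (le_of_eq ?_)
      obtain ⟨m, rfl⟩ : ∃ m, s = m + 1 := ⟨s - 1, by omega⟩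
      rw [Nat.add_sub_cancel]
      ring
    · intro ν hν
      have : (ν : ℝ) ≤ s := by
        have := Finset.mem_range_succ_iff.1 hν
        exact_mod_cast this
      rw [abs_of_nonneg (mul_nonneg (by linarith) h0.le)]
      gcongr
      linarith [(Nat.cast_nonneg ν : (0:ℝ) ≤ ν)]
    · intro j hj
      have := moments hj 0
      simp_rw [mul_pow]
      calc _ = h ^ j * ∑ ν ∈ Finset.range (s + 1), ((-1 : ℝ) ^ ν * (s.choose ν : ℝ)) *
            (0 + ((s:ℝ) - ν)) ^ j := by
              rw [Finset.mul_sum]; exact Finset.sum_congr rfl fun i _ => by rw [zero_add]; ring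
        _ = 0 := by rw [this, mul_zero]
  calc LpNorm p (Delta s h g) ≤ LpNorm p (fun x => 2 ^ (s + 1) * (s * h) ^ s * W x) :=
        LpNorm_mono hp (Delta_mem hp s h (hg.mem hp)) (w1.const_mul hp _)
          fun x => (hb x).trans (le_abs_self _)
    _ = 2 ^ (s + 1) * (s * h) ^ s * LpNorm p W := by
        rw [LpNorm_const_mul hp _ w1, abs_of_nonneg (by positivity)]
    _ ≤ 2 ^ (s + 1) * (s * δ) ^ s * LpNorm p (iteratedDeriv s g) := by
        have := LpNorm_nonneg p W
        gcongr
    _ = _ := by rw [mul_pow]; ring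

lemma jensen_window {p : ℝ} (hp : 1 ≤ p) {v : ℝ → ℝ} (hv : MemLpT p v) (a b : ℝ) (hab : a < b) :
    ((b - a)⁻¹ * ∫ t in a..b, |v t|) ^ p ≤ (b - a)⁻¹ * ∫ t in a..b, |v t| ^ p := by
  have hper : Function.Periodic (fun x => |v x| ^ p) 1 := fun x => by simp [hv.1 x]
  have hi := hper.intervalIntegrable (t := 0) one_ne_zero (by simpa using hv.2.2) a b
  have h := ConvexOn.map_set_average_le (μ := volume) (t := Set.Ioc a b) (f := fun t => |v t|)
    (convexOn_rpow hp) (continuousOn_id.rpow_const fun x _ => Or.inr (by linarith)) isClosed_Ici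
    (by simpa using hab) (by simp) (Eventually.of_forall fun x => Set.mem_Ici.2 (abs_nonneg (v x)))
    ((intervalIntegrable_iff_integrableOn_Ioc_of_le hab.le).1 (hv.abs.locInt hp a b))
    ((intervalIntegrable_iff_integrableOn_Ioc_of_le hab.le).1 hi)
  have e := interval_average_eq (fun t => |v t|) a b
  have e2 := interval_average_eq (fun t => |v t| ^ p) a b
  rw [Set.uIoc_of_le hab.le, smul_eq_mul] at e e2
  rw [e, e2] at h
  exact h

lemma nodes_sum {γ : ℝ} {X : ℕ → ℕ → ℝ} (hγ0 : 0 < γ) (hX : NodesOK γ X) {n : ℕ} (hn : 1 ≤ n)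
    {w : ℝ → ℝ} (hw0 : ∀ x, 0 ≤ w x) (hper : Function.Periodic w 1)
    (hi : ∀ a b, IntervalIntegrable w volume a b) :
    ∑ k ∈ Finset.range n, ∫ t in (X n k - γ / n / 2)..(X n k + γ / n / 2), w t ≤
      ∫ t in (0:ℝ)..1, w t := by
  obtain ⟨-, -, -, h4, h5⟩ := hX n hn
  set δ := γ / (n:ℝ) with hδ
  have hδ0 : 0 < δ := by positivity
  have key : ∀ m, m + 1 ≤ n →
      ∑ k ∈ Finset.range (m + 1), ∫ t in (X n k - δ / 2)..(X n k + δ / 2), w t ≤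
      ∫ t in (X n 0 - δ / 2)..(X n m + δ / 2), w t := by
    intro m
    induction m with
    | zero => simp
    | succ m ih =>
      intro hm
      rw [Finset.sum_range_succ]
      have h1 := ih (by omega)
      have h2 := h4 m (by omega)
      have e1 := intervalIntegral.integral_add_adjacent_intervals
        (hi (X n 0 - δ / 2) (X n m + δ / 2)) (hi (X n m + δ / 2) (X n (m + 1) - δ / 2))
      have e2 := intervalIntegral.integral_add_adjacent_intervals
        (hi (X n 0 - δ / 2) (X n (m + 1) - δ / 2)) (hi (X n (m + 1) - δ / 2) (X n (m + 1) + δ / 2))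
      have h3 : 0 ≤ ∫ t in (X n m + δ / 2)..(X n (m + 1) - δ / 2), w t :=
        intervalIntegral.integral_nonneg (by linarith) fun t _ => hw0 t
      linarith
  have h1 := key (n - 1) (by omega)
  rw [Nat.sub_add_cancel hn] at h1
  have e1 := intervalIntegral.integral_add_adjacent_intervals
        (hi (X n 0 - δ / 2) (X n (n - 1) + δ / 2)) (hi (X n (n - 1) + δ / 2) (X n 0 - δ / 2 + 1))
  have h3 : 0 ≤ ∫ t in (X n (n - 1) + δ / 2)..(X n 0 - δ / 2 + 1), w t :=
        intervalIntegral.integral_nonneg (by linarith) fun t _ => hw0 t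
  have e2 := hper.intervalIntegral_add_eq (X n 0 - δ / 2) 0
  rw [zero_add] at e2
  linarith

lemma ellp_node {p γ : ℝ} (hp : 1 ≤ p) {X : ℕ → ℕ → ℝ} (hγ0 : 0 < γ) (hγ1 : γ ≤ 1)
    (hX : NodesOK γ X) {n : ℕ} (hn : 1 ≤ n)
    {v u : ℝ → ℝ} (hv : MemLpT p v) {C : ℝ} (hC : 0 ≤ C)
    (hu : ∀ x, |u x| ≤ C * ((γ / n)⁻¹ * ∫ t in (x - γ / n / 2)..(x + γ / n / 2), |v t|)) :
    ellp p n (X n) u ≤ C / γ * LpNorm p v := by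
  have hp0 : 0 < p := by linarith
  have hn0 : (0:ℝ) < n := by exact_mod_cast hn
  have hper : Function.Periodic (fun x => |v x| ^ p) 1 := fun x => by simp [hv.1 x]
  have hi := hper.intervalIntegrable (t := 0) one_ne_zero (by simpa using hv.2.2)
  have hsum := nodes_sum hγ0 hX hn (w := fun x => |v x| ^ p) (fun x => by positivity) hper hi
  have hδ0 : 0 < γ / (n:ℝ) := by positivity
  have h1 : ∀ k ∈ Finset.range n, |u (X n k)| ^ p ≤ C ^ p * ((γ / n)⁻¹ *
      ∫ t in (X n k - γ / n / 2)..(X n k + γ / n / 2), |v t| ^ p) := by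
    intro k _
    have hJ := jensen_window hp hv (X n k - γ / n / 2) (X n k + γ / n / 2) (by linarith)
    have e : X n k + γ / n / 2 - (X n k - γ / n / 2) = γ / n := by ring
    rw [e] at hJ
    have hnn : 0 ≤ (γ / n)⁻¹ * ∫ t in (X n k - γ / n / 2)..(X n k + γ / n / 2), |v t| :=
      mul_nonneg (by positivity)
        (intervalIntegral.integral_nonneg (by linarith) fun t _ => abs_nonneg _)
    calc |u (X n k)| ^ p ≤ (C * ((γ / n)⁻¹ *
          ∫ t in (X n k - γ / n / 2)..(X n k + γ / n / 2), |v t|)) ^ p :=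
          Real.rpow_le_rpow (abs_nonneg _) (hu _) hp0.le
      _ = C ^ p * ((γ / n)⁻¹ * ∫ t in (X n k - γ / n / 2)..(X n k + γ / n / 2), |v t|) ^ p :=
          Real.mul_rpow hC hnn
      _ ≤ _ := by gcongr
  have hI : 0 ≤ ∫ t in (0:ℝ)..1, |v t| ^ p :=
    intervalIntegral.integral_nonneg zero_le_one fun t _ => by positivity
  have h2 : (1 / (n:ℝ)) * ∑ k ∈ Finset.range n, |u (X n k)| ^ p ≤
      (C / γ) ^ p * ∫ t in (0:ℝ)..1, |v t| ^ p := by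
    calc (1 / (n:ℝ)) * ∑ k ∈ Finset.range n, |u (X n k)| ^ p
        ≤ (1 / (n:ℝ)) * ∑ k ∈ Finset.range n, C ^ p * ((γ / n)⁻¹ *
          ∫ t in (X n k - γ / n / 2)..(X n k + γ / n / 2), |v t| ^ p) := by
          gcongr with k hk
          exact h1 k hk
      _ = (1 / (n:ℝ)) * (C ^ p * ((γ / n)⁻¹ * ∑ k ∈ Finset.range n,
          ∫ t in (X n k - γ / n / 2)..(X n k + γ / n / 2), |v t| ^ p)) := by
          simp_rw [Finset.mul_sum]
      _ ≤ (1 / (n:ℝ)) * (C ^ p * ((γ / n)⁻¹ * ∫ t in (0:ℝ)..1, |v t| ^ p)) := by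
          gcongr
      _ = C ^ p * (1 / γ) * ∫ t in (0:ℝ)..1, |v t| ^ p := by
          field_simp
      _ ≤ C ^ p * (1 / γ) ^ p * ∫ t in (0:ℝ)..1, |v t| ^ p := by
          gcongr
          apply Real.self_le_rpow_of_one_le _ hp
          rw [le_div_iff₀ hγ0]; linarith
      _ = _ := by
          rw [← Real.mul_rpow hC (by positivity)]
          congr 2; ring
  unfold ellp LpNorm
  calc _ ≤ ((C / γ) ^ p * ∫ t in (0:ℝ)..1, |v t| ^ p) ^ (1 / p) :=
        Real.rpow_le_rpow (by positivity) h2 (by positivity)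
    _ = _ := by
        rw [Real.mul_rpow (by positivity) hI, ← Real.rpow_mul (by positivity),
          mul_one_div_cancel hp0.ne', Real.rpow_one]

lemma ellp_nonneg (p : ℝ) (n : ℕ) (x : ℕ → ℝ) (f : ℝ → ℝ) : 0 ≤ ellp p n x f := by
  unfold ellp; positivity

lemma ellp_add_le {p : ℝ} (hp : 1 ≤ p) (n : ℕ) (x : ℕ → ℝ) (f g : ℝ → ℝ) :
    ellp p n x (fun t => f t + g t) ≤ ellp p n x f + ellp p n x g := by
  unfold ellp
  rw [Real.mul_rpow (by positivity) (by positivity), Real.mul_rpow (by positivity) (by positivity),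
    Real.mul_rpow (by positivity) (by positivity), ← mul_add]
  gcongr
  exact Real.Lp_add_le _ _ _ hp

lemma ellp_sub_comm (p : ℝ) (n : ℕ) (x : ℕ → ℝ) (f g : ℝ → ℝ) :
    ellp p n x (fun t => f t - g t) = ellp p n x (fun t => g t - f t) := by
  simp [ellp, abs_sub_comm]

lemma intInt_sum (S : Finset ℕ) {F : ℕ → ℝ → ℝ} {a b : ℝ}
    (h : ∀ ν ∈ S, IntervalIntegrable (F ν) volume a b) :
    IntervalIntegrable (fun t => ∑ ν ∈ S, F ν t) volume a b := by
  have h1 := IntervalIntegrable.sum S h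
  have e : (fun t => ∑ ν ∈ S, F ν t) = ∑ ν ∈ S, F ν := by
    funext t; rw [Finset.sum_apply]
  rw [e]; exact h1

lemma scaled_int {p : ℝ} (hp : 1 ≤ p) {f : ℝ → ℝ} (hf : MemLpT p f) (x c a b : ℝ) :
    IntervalIntegrable (fun t => f (x + c * t)) volume a b := by
  rcases eq_or_ne c 0 with rfl | hc
  · simp
  have h1 := (hf.locInt hp (x + c * a) (x + c * b)).comp_add_left x
  have h2 := h1.comp_mul_left (c := c)
  have e1 : (x + c * a - x) / c = a := by field_simp; ring
  have e2 : (x + c * b - x) / c = b := by field_simp; ring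
  rw [e1, e2] at h2
  exact h2

lemma choose_inv_le (r : ℕ) : (((2 * r).choose r : ℝ))⁻¹ ≤ 1 := by
  apply inv_le_one_of_one_le₀
  exact_mod_cast Nat.succ_le_of_lt (Nat.choose_pos (by omega))

lemma steklov_int {p : ℝ} (hp : 1 ≤ p) (r : ℕ) {f : ℝ → ℝ} (hf : MemLpT p f) (x a b : ℝ) (ν : ℕ) :
    IntervalIntegrable (fun t => (-1 : ℝ) ^ ν * (((2 * r).choose ν : ℝ)) *
      f (x + (((r : ℝ) - (ν : ℝ)) / (r : ℝ)) * t)) volume a b :=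
  (scaled_int hp hf x _ a b).const_mul _

lemma steklov_sub {p : ℝ} (hp : 1 ≤ p) (r : ℕ) (δ : ℝ) {f g : ℝ → ℝ} (hf : MemLpT p f)
    (hg : MemLpT p g) (x : ℝ) :
    steklov r δ (fun x => f x - g x) x = steklov r δ f x - steklov r δ g x := by
  unfold steklov
  rw [← mul_sub, ← intervalIntegral.integral_sub]
  · congr 2
    funext t
    rw [← Finset.sum_sub_distrib]
    exact Finset.sum_congr rfl fun ν _ => by ring
  · exact intInt_sum _ fun ν _ => steklov_int hp r hf x _ _ ν
  · exact intInt_sum _ fun ν _ => steklov_int hp r hg x _ _ ν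

lemma steklov_bound {p : ℝ} (hp : 1 ≤ p) {r : ℕ} (hr : 1 ≤ r) {δ : ℝ} (hδ : 0 < δ) {f : ℝ → ℝ}
    (hf : MemLpT p f) (x : ℝ) :
    |steklov r δ f x| ≤ (2 * ∑ ν ∈ Finset.range r, ((2 * r).choose ν : ℝ) * r) *
      (δ⁻¹ * ∫ t in (x - δ / 2)..(x + δ / 2), |f t|) := by
  have hr0 : (0:ℝ) < r := by exact_mod_cast hr
  set I := ∫ t in (x - δ / 2)..(x + δ / 2), |f t| with hI
  have hI0 : 0 ≤ I := intervalIntegral.integral_nonneg (by linarith) fun t _ => abs_nonneg _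
  have h1 : |∫ t in (-(δ / 2))..(δ / 2), ∑ ν ∈ Finset.range r,
        (-1 : ℝ) ^ ν * (((2 * r).choose ν : ℝ)) * f (x + (((r : ℝ) - (ν : ℝ)) / (r : ℝ)) * t)|
      ≤ ∑ ν ∈ Finset.range r, ((2 * r).choose ν : ℝ) * r * I := by
    rw [intervalIntegral.integral_finsetSum fun ν _ => steklov_int hp r hf x _ _ ν]
    refine (Finset.abs_sum_le_sum_abs _ _).trans (Finset.sum_le_sum fun ν hν => ?_)
    have hν' : ν + 1 ≤ r := Finset.mem_range.1 hν
    have hν2 : (ν:ℝ) + 1 ≤ r := by exact_mod_cast hν'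
    have hν0 : (0:ℝ) ≤ ν := Nat.cast_nonneg ν
    rw [intervalIntegral.integral_const_mul, abs_mul, mul_assoc]
    have e : |(-1 : ℝ) ^ ν * (((2 * r).choose ν : ℝ))| = ((2 * r).choose ν : ℝ) := by simp [abs_mul]
    rw [e]
    gcongr
    set c : ℝ := ((r:ℝ) - ν) / r with hc
    have hc0 : 0 < c := by apply div_pos <;> linarith
    have hc1 : c ≤ 1 := by rw [hc, div_le_one hr0]; linarith
    have hcr : c⁻¹ ≤ r := by
      rw [hc, inv_div, div_le_iff₀ (by linarith)]
      nlinarith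
    calc |∫ t in (-(δ / 2))..(δ / 2), f (x + c * t)|
        ≤ ∫ t in (-(δ / 2))..(δ / 2), |f (x + c * t)| :=
          intervalIntegral.abs_integral_le_integral_abs (by linarith)
      _ = c⁻¹ * ∫ t in (x + c * (-(δ / 2)))..(x + c * (δ / 2)), |f t| := by
          rw [intervalIntegral.integral_comp_add_mul (fun t => |f t|) hc0.ne', smul_eq_mul]
      _ ≤ r * I := by
          apply mul_le_mul hcr _ _ hr0.le
          · apply intervalIntegral.integral_mono_interval
            · nlinarith
            · nlinarith
            · nlinarith
            · exact Eventually.of_forall fun t => abs_nonneg _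
            · exact hf.abs.locInt hp _ _
          · exact intervalIntegral.integral_nonneg (by nlinarith) fun t _ => abs_nonneg _
  rw [← Finset.sum_mul] at h1
  unfold steklov
  rw [abs_mul, abs_mul, abs_mul]
  have e1 : |(-1 : ℝ) ^ (r + 1)| = 1 := by simp
  have e2 : |(((2 * r).choose r : ℝ))⁻¹| ≤ 1 := by
    rw [abs_of_nonneg (by positivity)]; exact choose_inv_le r
  have e3 : |2 / δ| = 2 / δ := abs_of_pos (by positivity)
  rw [e1, e3, one_mul]
  calc _ ≤ 1 * (2 / δ) * ((∑ ν ∈ Finset.range r, ((2 * r).choose ν : ℝ) * r) * I) := by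
        gcongr
    _ = _ := by ring

lemma sum_symm_split (r : ℕ) (F : ℕ → ℝ) :
    ∑ ν ∈ Finset.range (2 * r + 1), F ν =
      ∑ ν ∈ Finset.range r, F ν + F r + ∑ ν ∈ Finset.range r, F (2 * r - ν) := by
  have e : 2 * r + 1 = r + (r + 1) := by ring
  rw [e, Finset.sum_range_add, Finset.sum_range_succ' (fun i => F (r + i)),
    ← Finset.sum_range_reflect (fun i => F (r + (i + 1)))]
  have : ∀ ν ∈ Finset.range r, F (r + (r - 1 - ν + 1)) = F (2 * r - ν) := by
    intro ν hν
    have := Finset.mem_range.1 hν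
    congr 1
    omega
  rw [Finset.sum_congr rfl this]
  simp only [add_zero]
  ring

lemma steklov_sub_self {p : ℝ} (hp : 1 ≤ p) {r : ℕ} (hr : 1 ≤ r) {δ : ℝ} (hδ : 0 < δ) {f : ℝ → ℝ}
    (hf : MemLpT p f) (x : ℝ) :
    steklov r δ f x - f x = (-1 : ℝ) ^ (r + 1) * (((2 * r).choose r : ℝ))⁻¹ * δ⁻¹ *
      ∫ t in (-(δ / 2))..(δ / 2), ∑ ν ∈ Finset.range (2 * r + 1),
        (-1 : ℝ) ^ ν * (((2 * r).choose ν : ℝ)) * f (x + (((r : ℝ) - (ν : ℝ)) / (r : ℝ)) * t) := by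
  have hr0 : (0:ℝ) < r := by exact_mod_cast hr
  set S : ℝ → ℝ := fun t => ∑ ν ∈ Finset.range r,
        (-1 : ℝ) ^ ν * (((2 * r).choose ν : ℝ)) * f (x + (((r : ℝ) - (ν : ℝ)) / (r : ℝ)) * t) with hS
  have hSi : ∀ a b, IntervalIntegrable S volume a b := fun a b =>
    intInt_sum _ fun ν _ => steklov_int hp r hf x _ _ ν
  have hcpos : (0:ℝ) < ((2 * r).choose r : ℝ) := by
    exact_mod_cast Nat.choose_pos (by omega)
  have e : ∀ t, ∑ ν ∈ Finset.range (2 * r + 1),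
        (-1 : ℝ) ^ ν * (((2 * r).choose ν : ℝ)) * f (x + (((r : ℝ) - (ν : ℝ)) / (r : ℝ)) * t) =
        S t + (-1 : ℝ) ^ r * ((2 * r).choose r : ℝ) * f x + S (-t) := by
    intro t
    rw [sum_symm_split]
    congr 1
    · simp [hS]
    · refine Finset.sum_congr rfl fun ν hν => ?_
      have h1 := Finset.mem_range.1 hν
      rw [Nat.choose_symm (by omega), Nat.cast_sub (by omega)]
      have e1 : (-1 : ℝ) ^ (2 * r - ν) = (-1) ^ ν := by
        have : (-1 : ℝ) ^ (2 * r - ν) * (-1) ^ ν = 1 := by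
          rw [← pow_add, Nat.sub_add_cancel (by omega), pow_mul]; simp
        rcases neg_one_pow_eq_or ℝ ν with h | h <;> rw [h] at this ⊢ <;> linarith
      rw [e1]
      congr 3
      push_cast
      ring
  simp_rw [e]
  rw [intervalIntegral.integral_add ((hSi _ _).add intervalIntegrable_const)
      (by simpa using (IntervalIntegrable.iff_comp_neg).1 (hSi (δ / 2) (-(δ / 2)))),
    intervalIntegral.integral_add (hSi _ _) intervalIntegrable_const,
    intervalIntegral.integral_comp_neg (fun t => S t), intervalIntegral.integral_const, neg_neg]
  have hst : steklov r δ f x = (-1 : ℝ) ^ (r + 1) * (((2 * r).choose r : ℝ))⁻¹ * (2 / δ) *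
    ∫ t in (-(δ / 2))..(δ / 2), S t := rfl
  rw [hst]
  set I := ∫ t in (-(δ / 2))..(δ / 2), S t
  have e2 : (-1 : ℝ) ^ (r + 1) * (-1) ^ r = -1 := by
    rw [← pow_add, show r + 1 + r = 2 * r + 1 by ring, pow_succ, pow_mul]; simp
  simp only [smul_eq_mul]
  have e3 : (-1 : ℝ) ^ (r + 1) * (((2 * r).choose r : ℝ))⁻¹ * δ⁻¹ *
      (I + (δ / 2 - -(δ / 2)) * ((-1) ^ r * ((2 * r).choose r : ℝ) * f x) + I) =
      (-1 : ℝ) ^ (r + 1) * (((2 * r).choose r : ℝ))⁻¹ * (2 / δ) * I +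
      ((-1 : ℝ) ^ (r + 1) * (-1) ^ r) * ((((2 * r).choose r : ℝ))⁻¹ * ((2 * r).choose r : ℝ)) *
        (δ⁻¹ * δ) * f x := by
    ring
  rw [e3, e2, inv_mul_cancel₀ hcpos.ne', inv_mul_cancel₀ hδ.ne']
  ring

lemma steklov_smooth {p : ℝ} (hp : 1 ≤ p) {r s : ℕ} (hr : 1 ≤ r) (hs : 1 ≤ s) (hsr : s ≤ 2 * r)
    {δ : ℝ} (hδ : 0 < δ) {g : ℝ → ℝ} (hg : SobolevW s g) (x : ℝ) :
    |steklov r δ g x - g x| ≤ (2 ^ (2 * r) * δ ^ s) *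
      (δ⁻¹ * ∫ t in (x - δ / 2)..(x + δ / 2), |iteratedDeriv s g t|) := by
  have hr0 : (0:ℝ) < r := by exact_mod_cast hr
  rw [steklov_sub_self hp hr hδ (hg.mem hp) x]
  set J := ∫ t in (x - δ / 2)..(x + δ / 2), |iteratedDeriv s g t| with hJ
  have hJ0 : 0 ≤ J := intervalIntegral.integral_nonneg (by linarith) fun t _ => abs_nonneg _
  have hb : ∀ t ∈ Set.uIoc (-(δ / 2)) (δ / 2), ‖∑ ν ∈ Finset.range (2 * r + 1),
        (-1 : ℝ) ^ ν * (((2 * r).choose ν : ℝ)) * g (x + (((r : ℝ) - (ν : ℝ)) / (r : ℝ)) * t)‖ ≤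
        2 ^ (2 * r) * ((δ / 2) ^ (s - 1) * J) := by
    intro t ht
    rw [Set.uIoc_of_le (by linarith)] at ht
    have hta : |t| ≤ δ / 2 := abs_le.2 ⟨ht.1.le, ht.2⟩
    rw [Real.norm_eq_abs]
    have := functional_bound hs hg.2 x (δ / 2) (Finset.range (2 * r + 1))
      (fun ν => (-1 : ℝ) ^ ν * ((2 * r).choose ν : ℝ)) (fun ν => (((r:ℝ) - ν) / r) * t) ?_ ?_
    · rw [sum_abs_choose] at this
      exact this
    · intro ν hν
      have h1 : (ν : ℝ) ≤ 2 * r := by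
        have := Finset.mem_range_succ_iff.1 hν
        exact_mod_cast this
      have h2 : (0:ℝ) ≤ ν := Nat.cast_nonneg ν
      rw [abs_mul]
      have : |((r:ℝ) - ν) / r| ≤ 1 := by
        rw [abs_div, abs_of_pos hr0, div_le_one hr0, abs_le]
        constructor <;> linarith
      calc _ ≤ 1 * |t| := by gcongr
        _ ≤ _ := by linarith
    · intro j hj
      have := moments (N := 2 * r) (lt_of_lt_of_le hj hsr) (-(r:ℝ))
      calc _ = (t / r) ^ j * ∑ ν ∈ Finset.range (2 * r + 1), ((-1 : ℝ) ^ ν *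
            ((2 * r).choose ν : ℝ)) * (-(r:ℝ) + (((2 * r : ℕ):ℝ) - ν)) ^ j := by
              rw [Finset.mul_sum]
              refine Finset.sum_congr rfl fun i _ => ?_
              rw [mul_left_comm, ← mul_pow]
              congr 2
              push_cast
              ring
        _ = 0 := by rw [this, mul_zero]
  have h1 := intervalIntegral.norm_integral_le_of_norm_le_const hb
  rw [Real.norm_eq_abs] at h1
  have e0 : |δ / 2 - -(δ / 2)| = δ := by
    rw [show δ / 2 - -(δ / 2) = δ by ring, abs_of_pos hδ]
  rw [e0] at h1
  rw [abs_mul, abs_mul, abs_mul]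
  have e1 : |(-1 : ℝ) ^ (r + 1)| = 1 := by simp
  have e2 : |(((2 * r).choose r : ℝ))⁻¹| ≤ 1 := by
    rw [abs_of_nonneg (by positivity)]; exact choose_inv_le r
  have e3 : |δ⁻¹| = δ⁻¹ := abs_of_pos (by positivity)
  rw [e1, e3, one_mul]
  calc _ ≤ 1 * δ⁻¹ * (2 ^ (2 * r) * ((δ / 2) ^ (s - 1) * J) * δ) := by
        gcongr
    _ = 2 ^ (2 * r) * (δ / 2) ^ (s - 1) * J * (δ⁻¹ * δ) := by ring
    _ ≤ 2 ^ (2 * r) * δ ^ (s - 1) * J * (δ⁻¹ * δ) := by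
        gcongr
        linarith
    _ = _ := by
        obtain ⟨m, rfl⟩ : ∃ m, s = m + 1 := ⟨s - 1, by omega⟩
        rw [Nat.add_sub_cancel]
        ring

noncomputable def AA (h : ℝ) (F : ℝ → ℝ) (x : ℝ) : ℝ := ∫ u in (0:ℝ)..1, F (x + h * u)

noncomputable def DD (h : ℝ) (F : ℝ → ℝ) (x : ℝ) : ℝ := h⁻¹ * (F (x + h) - F x)

lemma AA_mem {p : ℝ} (hp : 1 ≤ p) (h : ℝ) {F : ℝ → ℝ} (hF : MemLpT p F) :
    MemLpT p (AA h F) ∧ LpNorm p (AA h F) ≤ LpNorm p F := by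
  have h1 := average_mem hp nu0 (F := fun x u => F (x + h * u)) (M := LpNorm p F)
    (by
      have := hF.2.1
      exact this.comp (by fun_prop : Measurable fun z : ℝ × ℝ => z.1 + h * z.2))
    (LpNorm_nonneg p F) (fun u => hF.shift hp (h * u))
    (Eventually.of_forall fun u => (LpNorm_shift (h * u) hF.1).le)
  have e : AA h F = fun x => ∫ u, F (x + h * u) ∂nu0 := by
    funext x
    unfold AA
    rw [intervalIntegral.integral_of_le zero_le_one]
  rw [e]
  exact h1

lemma AA_iter_mem {p : ℝ} (hp : 1 ≤ p) (h : ℝ) {F : ℝ → ℝ} (hF : MemLpT p F) (m : ℕ) :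
    MemLpT p ((AA h)^[m] F) := by
  induction m with
  | zero => exact hF
  | succ m ih => rw [Function.iterate_succ_apply']; exact (AA_mem hp h ih).1

lemma AA_zero (F : ℝ → ℝ) : AA 0 F = F := by
  funext x; simp [AA]

lemma AA_zero_iter (F : ℝ → ℝ) (m : ℕ) : (AA 0)^[m] F = F := by
  induction m with
  | zero => rfl
  | succ m ih => rw [Function.iterate_succ_apply', ih, AA_zero]

lemma AA_eq {h : ℝ} (hh : h ≠ 0) (F : ℝ → ℝ) (x : ℝ) :
    AA h F x = h⁻¹ * ∫ t in x..(x + h), F t := by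
  unfold AA
  rw [intervalIntegral.integral_comp_add_mul F hh]
  simp

lemma AA_cont {p : ℝ} (hp : 1 ≤ p) {h : ℝ} (hh : h ≠ 0) {F : ℝ → ℝ} (hF : MemLpT p F) :
    Continuous (AA h F) := by
  have hc : Continuous fun x => ∫ t in (0:ℝ)..x, F t :=
    intervalIntegral.continuous_primitive (fun a b => hF.locInt hp a b) 0
  have e : AA h F = fun x => h⁻¹ * ((∫ t in (0:ℝ)..(x + h), F t) - ∫ t in (0:ℝ)..x, F t) := by
    funext x
    rw [AA_eq hh, intervalIntegral.integral_interval_sub_left (hF.locInt hp _ _) (hF.locInt hp _ _)]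
  rw [e]
  have hc2 : Continuous fun x => ∫ t in (0:ℝ)..(x + h), F t := hc.comp (continuous_add_const h)
  exact continuous_const.mul (hc2.sub hc)

lemma AA_deriv {h : ℝ} (hh : h ≠ 0) {F : ℝ → ℝ} (hF : Continuous F) (x : ℝ) :
    HasDerivAt (AA h F) (DD h F x) x := by
  have hc : ∀ y, HasDerivAt (fun x => ∫ t in (0:ℝ)..x, F t) (F y) y := fun y =>
    intervalIntegral.integral_hasDerivAt_right (hF.intervalIntegrable _ _)
      (hF.stronglyMeasurableAtFilter _ _) hF.continuousAt
  have e : AA h F = fun x => h⁻¹ * ((∫ t in (0:ℝ)..(x + h), F t) - ∫ t in (0:ℝ)..x, F t) := by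
    funext x
    rw [AA_eq hh, intervalIntegral.integral_interval_sub_left (hF.intervalIntegrable _ _)
      (hF.intervalIntegrable _ _)]
  rw [e]
  exact (((hc (x + h)).comp_add_const x h).sub (hc x)).const_mul h⁻¹

lemma DD_contDiff {k : ℕ} {h : ℝ} {F : ℝ → ℝ} (hF : ContDiff ℝ (k : ℕ∞) F) :
    ContDiff ℝ (k : ℕ∞) (DD h F) := by
  unfold DD
  have : ContDiff ℝ (k : ℕ∞) (fun x => F (x + h)) := hF.comp (contDiff_id.add contDiff_const)
  exact contDiff_const.mul (this.sub hF)

lemma DD_iteratedDeriv {k : ℕ} {h : ℝ} {F : ℝ → ℝ} (hF : ContDiff ℝ (k : ℕ∞) F) :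
    iteratedDeriv k (DD h F) = DD h (iteratedDeriv k F) := by
  funext x
  have h1 : ContDiff ℝ (k : ℕ∞) (fun x => F (x + h)) := hF.comp (contDiff_id.add contDiff_const)
  have h2 : ContDiff ℝ (k : ℕ∞) (fun x => F (x + h) - F x) := h1.sub hF
  unfold DD
  rw [iteratedDeriv_const_mul_field, iteratedDeriv_fun_sub h1.contDiffAt hF.contDiffAt,
    iteratedDeriv_comp_add_const]

lemma AA_iter_smooth {h : ℝ} (hh : h ≠ 0) {F : ℝ → ℝ} (hF : Continuous F) (k : ℕ) :
    ContDiff ℝ (k : ℕ∞) ((AA h)^[k] F) ∧ iteratedDeriv k ((AA h)^[k] F) = (DD h)^[k] F := by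
  induction k with
  | zero => 
    refine ⟨?_, ?_⟩
    · simpa using hF
    · simp
  | succ k ih =>
    obtain ⟨ih1, ih2⟩ := ih
    rw [Function.iterate_succ_apply', Function.iterate_succ_apply']
    have hd : deriv (AA h ((AA h)^[k] F)) = DD h ((AA h)^[k] F) :=
      funext fun x => (AA_deriv hh ih1.continuous x).deriv
    constructor
    · have := (contDiff_succ_iff_deriv (𝕜 := ℝ) (n := ((k : ℕ∞) : WithTop ℕ∞)) (f := AA h ((AA h)^[k] F))).2
        ⟨fun x => (AA_deriv hh ih1.continuous x).differentiableAt, by simp, by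
          rw [hd]; exact DD_contDiff ih1⟩
      exact_mod_cast this
    · rw [iteratedDeriv_succ', hd, DD_iteratedDeriv ih1, ih2]

lemma DD_mem {p : ℝ} (hp : 1 ≤ p) (h : ℝ) {F : ℝ → ℝ} (hF : MemLpT p F) : MemLpT p (DD h F) :=
  ((hF.shift hp h).sub hp hF).const_mul hp _

lemma DD_iter_mem {p : ℝ} (hp : 1 ≤ p) (h : ℝ) {F : ℝ → ℝ} (hF : MemLpT p F) (k : ℕ) :
    MemLpT p ((DD h)^[k] F) := by
  induction k with
  | zero => exact hF
  | succ m ih => rw [Function.iterate_succ_apply']; exact DD_mem hp h ih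

lemma DD_AA {p : ℝ} (hp : 1 ≤ p) (h : ℝ) {F : ℝ → ℝ} (hF : MemLpT p F) :
    DD h (AA h F) = AA h (DD h F) := by
  funext x
  unfold DD AA
  rw [intervalIntegral.integral_const_mul, intervalIntegral.integral_sub]
  · congr 3
    funext u
    congr 1
    ring
  · have := scaled_int hp hF (x + h) h 0 1
    convert this using 3
    ring
  · exact scaled_int hp hF x h 0 1

lemma DD_iter_AA {p : ℝ} (hp : 1 ≤ p) (h : ℝ) {F : ℝ → ℝ} (hF : MemLpT p F) (k : ℕ) :
    (DD h)^[k] (AA h F) = AA h ((DD h)^[k] F) := by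
  induction k with
  | zero => rfl
  | succ k ih =>
    rw [Function.iterate_succ_apply', Function.iterate_succ_apply', ih,
      DD_AA hp h (DD_iter_mem hp h hF k)]

lemma DD_iter_fwd (h : ℝ) (F : ℝ → ℝ) (k : ℕ) :
    (DD h)^[k] F = fun x => (h⁻¹) ^ k * (fwdDiff h)^[k] F x := by
  induction k with
  | zero => simp
  | succ k ih =>
    rw [Function.iterate_succ_apply', Function.iterate_succ_apply', ih]
    funext x
    simp only [DD, fwdDiff]
    ring

lemma fwd_Delta (h : ℝ) (F : ℝ → ℝ) (k : ℕ) (x : ℝ) :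
    (fwdDiff h)^[k] F x = Delta k h F x := by
  rw [fwdDiff_iter_eq_sum_shift, ← Finset.sum_range_reflect]
  unfold Delta
  refine Finset.sum_congr rfl fun ν hν => ?_
  have h1 : ν ≤ k := Nat.lt_succ_iff.1 (Finset.mem_range.1 hν)
  have e1 : k + 1 - 1 - ν = k - ν := by omega
  have e2 : k - (k - ν) = ν := by omega
  rw [e1, e2, Nat.choose_symm h1]
  simp only [zsmul_eq_mul, nsmul_eq_mul, Nat.cast_sub h1]
  push_cast
  rfl

lemma DD_iter_eq (h : ℝ) (F : ℝ → ℝ) (k : ℕ) :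
    (DD h)^[k] F = fun x => (h⁻¹) ^ k * Delta k h F x := by
  rw [DD_iter_fwd]
  funext x
  rw [fwd_Delta]

lemma AA_final {p : ℝ} (hp : 1 ≤ p) {h : ℝ} (hh : 0 < h) {F : ℝ → ℝ} (hF : MemLpT p F) (s : ℕ) :
    SobolevW s ((AA h)^[s + 1] F) ∧
    LpNorm p (iteratedDeriv s ((AA h)^[s + 1] F)) ≤ (h⁻¹) ^ s * LpNorm p (Delta s h F) := by
  have hc := AA_cont hp hh.ne' hF
  have h1 := AA_iter_smooth hh.ne' hc s
  refine ⟨⟨(AA_iter_mem hp h hF (s + 1)).1, ?_⟩, ?_⟩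
  · rw [Function.iterate_succ_apply]; exact h1.1
  · rw [Function.iterate_succ_apply, h1.2, DD_iter_AA hp h hF s]
    refine (AA_mem hp h (DD_iter_mem hp h hF s)).2.trans ?_
    rw [DD_iter_eq, LpNorm_const_mul hp _ (Delta_mem hp s h hF), abs_of_pos (by positivity)]

noncomputable def Phi (s : ℕ) (h : ℝ) (f : ℝ → ℝ) (m : ℕ) (v x : ℝ) : ℝ :=
  ∑ ν ∈ Finset.range (s + 1), ((-1 : ℝ) ^ ν * (s.choose ν : ℝ)) *
    (AA (((s : ℝ) - ν) * h))^[m] f (x + ((s : ℝ) - ν) * h * v)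

lemma Phi_mem {p : ℝ} (hp : 1 ≤ p) (s : ℕ) (h : ℝ) {f : ℝ → ℝ} (hf : MemLpT p f) (m : ℕ) (v : ℝ) :
    MemLpT p (Phi s h f m v) :=
  MemLpT.sum hp _ fun ν _ =>
    ((AA_iter_mem hp (((s : ℝ) - ν) * h) hf m).shift hp (((s : ℝ) - ν) * h * v)).const_mul hp _

lemma Phi_succ {p : ℝ} (hp : 1 ≤ p) (s : ℕ) (h : ℝ) {f : ℝ → ℝ} (hf : MemLpT p f) (m : ℕ)
    (v x : ℝ) : Phi s h f (m + 1) v x = ∫ u in (0:ℝ)..1, Phi s h f m (v + u) x := by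
  unfold Phi
  rw [intervalIntegral.integral_finsetSum]
  · refine Finset.sum_congr rfl fun ν _ => ?_
    rw [intervalIntegral.integral_const_mul, Function.iterate_succ_apply']
    congr 1
    rw [AA]
    refine intervalIntegral.integral_congr fun u _ => ?_
    have e : x + ((s : ℝ) - ν) * h * v + ((s : ℝ) - ν) * h * u =
      x + ((s : ℝ) - ν) * h * (v + u) := by ring
    exact congrArg _ e
  · intro ν _
    have := (scaled_int hp (AA_iter_mem hp (((s : ℝ) - ν) * h) hf m)
      (x + ((s : ℝ) - ν) * h * v) (((s : ℝ) - ν) * h) 0 1).const_mul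
      ((-1 : ℝ) ^ ν * (s.choose ν : ℝ))
    convert this using 4
    ring

lemma Phi_bound {p : ℝ} (hp : 1 ≤ p) (s : ℕ) (h : ℝ) {f : ℝ → ℝ} (hf : MemLpT p f) {L M : ℝ}
    (hM0 : 0 ≤ M) (hM : ∀ v, 0 ≤ v → v ≤ L → LpNorm p (Delta s (h * v) f) ≤ M) (m : ℕ) :
    ∀ v, 0 ≤ v → v + m ≤ L → LpNorm p (Phi s h f m v) ≤ M := by
  induction m with
  | zero =>
    intro v hv hL
    have e : Phi s h f 0 v = Delta s (h * v) f := by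
      funext x
      unfold Phi Delta
      refine Finset.sum_congr rfl fun ν _ => ?_
      rw [Function.iterate_zero_apply, mul_assoc ((s : ℝ) - ν)]
    rw [e]
    exact hM v hv (by simpa using hL)
  | succ m ih =>
    intro v hv hL
    have e : Phi s h f (m + 1) v = fun x => ∫ u, Phi s h f m (v + u) x ∂nu0 := by
      funext x
      rw [Phi_succ hp s h hf, intervalIntegral.integral_of_le zero_le_one]
    rw [e]
    refine (average_mem hp nu0 (F := fun x u => Phi s h f m (v + u) x) ?_ hM0
      (fun u => Phi_mem hp s h hf m (v + u)) ?_).2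
    · unfold Phi
      refine Finset.measurable_sum _ fun ν _ => ?_
      refine Measurable.const_mul ?_ _
      exact (AA_iter_mem hp (((s : ℝ) - ν) * h) hf m).2.1.comp
        (by fun_prop : Measurable fun z : ℝ × ℝ => z.1 + ((s : ℝ) - ν) * h * (v + z.2))
    · refine (ae_restrict_mem measurableSet_Ioc).mono fun u hu => ?_
      apply ih (v + u) (by linarith [hu.1])
      push_cast at hL
      linarith [hu.2]

lemma Delta_zero_step {s : ℕ} (hs : 1 ≤ s) (f : ℝ → ℝ) : Delta s 0 f = fun _ => 0 := by
  funext x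
  unfold Delta
  simp only [mul_zero, add_zero]
  rw [← Finset.sum_mul]
  have h1 := Int.alternating_sum_range_choose_of_ne (n := s) (by omega)
  have h2 : ∑ ν ∈ Finset.range (s + 1), ((-1 : ℝ) ^ ν * (s.choose ν : ℝ)) = 0 := by
    exact_mod_cast h1
  rw [h2, zero_mul]

/-- The K-functional approximant. -/
lemma approximant {p : ℝ} (hp : 1 ≤ p) {s : ℕ} (hs : 1 ≤ s) {n : ℕ} (hn : 1 ≤ n) {f : ℝ → ℝ}
    (hf : MemLpT p f) :
    ∃ g, SobolevW s g ∧ LpNorm p (fun x => f x - g x) ≤ omegaMod s p f (1 / (n:ℝ)) ∧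
      (1 / (n:ℝ) ^ s) * LpNorm p (iteratedDeriv s g) ≤
        (2 ^ s * ((s:ℝ) + 2) ^ s) * omegaMod s p f (1 / (n:ℝ)) := by
  have hn0 : (0:ℝ) < n := by exact_mod_cast hn
  set ω := omegaMod s p f (1 / (n:ℝ)) with hω
  have hω0 : 0 ≤ ω := omega_nonneg s f
  set h : ℝ := 1 / (n * ((s:ℝ) + 2)) with hh
  have hs0 : (0:ℝ) ≤ s := Nat.cast_nonneg s
  have hh0 : 0 < h := by positivity
  have hhL : ∀ v : ℝ, v ≤ s + 1 → h * v < 1 / n := by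
    intro v hv
    rw [hh, div_mul_eq_mul_div, one_mul, div_lt_div_iff₀ (by positivity) hn0]
    nlinarith
  have hDel : ∀ v, 0 ≤ v → v ≤ (s:ℝ) + 1 → LpNorm p (Delta s (h * v) f) ≤ ω := by
    intro v hv hvL
    rcases hv.eq_or_lt with rfl | hv
    · rw [mul_zero, Delta_zero_step hs, LpNorm_zero hp]
      exact hω0
    · exact le_omega hp s hf (by positivity) (hhL v hvL)
  have hPhi := Phi_bound hp s h hf hω0 hDel (s + 1) 0 le_rfl (by push_cast; linarith)
  let T : ℕ → ℝ → ℝ := fun ν => (AA (((s : ℝ) - ν) * h))^[s + 1] f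
  let c : ℕ → ℝ := fun ν => -(-1) ^ s * ((-1 : ℝ) ^ ν * (s.choose ν : ℝ))
  have hT : ∀ ν ∈ Finset.range s, SobolevW s (T ν) ∧
      LpNorm p (iteratedDeriv s (T ν)) ≤ ((n:ℝ) * (s + 2)) ^ s * ω := by
    intro ν hν
    have hν' : ν + 1 ≤ s := Finset.mem_range.1 hν
    have hν2 : (ν:ℝ) + 1 ≤ s := by exact_mod_cast hν'
    have hν0 : (0:ℝ) ≤ ν := Nat.cast_nonneg ν
    have hpos : 0 < ((s : ℝ) - ν) * h := mul_pos (by linarith) hh0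
    obtain ⟨h1, h2⟩ := AA_final hp hpos hf s
    refine ⟨h1, h2.trans ?_⟩
    have h3 : LpNorm p (Delta s (((s : ℝ) - ν) * h) f) ≤ ω := by
      rw [mul_comm]; exact hDel _ (by linarith) (by linarith)
    have h4 : (((s : ℝ) - ν) * h)⁻¹ ≤ (n:ℝ) * (s + 2) := by
      rw [inv_le_comm₀ hpos (by positivity), ← one_div, ← hh]
      nlinarith
    have h5 : 0 ≤ LpNorm p (Delta s (((s : ℝ) - ν) * h) f) := LpNorm_nonneg _ _
    gcongr
  refine ⟨fun x => ∑ ν ∈ Finset.range s, c ν * T ν x, ⟨?_, ?_⟩, ?_, ?_⟩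
  · intro x
    exact Finset.sum_congr rfl fun ν hν => by rw [(hT ν hν).1.1 x]
  · exact ContDiff.sum fun ν hν => contDiff_const.mul (hT ν hν).1.2
  · have e : (fun x => f x - ∑ ν ∈ Finset.range s, c ν * T ν x) =
        fun x => (-1) ^ s * Phi s h f (s + 1) 0 x := by
      funext x
      unfold Phi
      rw [Finset.sum_range_succ]
      have e1 : (-1 : ℝ) ^ s * (-1) ^ s = 1 := by rw [← mul_pow]; simp
      have e2 : (AA (((s : ℝ) - s) * h))^[s + 1] f = f := by
        rw [sub_self, zero_mul, AA_zero_iter]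
      rw [e2]
      simp only [mul_zero, add_zero, Nat.choose_self, Nat.cast_one, mul_one]
      rw [mul_add, ← mul_assoc, e1, one_mul, Finset.mul_sum, sub_eq_add_neg, add_comm,
        ← Finset.sum_neg_distrib]
      congr 1
      exact Finset.sum_congr rfl fun ν _ => by simp only [c, T]; ring
    rw [e, LpNorm_const_mul hp _ (Phi_mem hp s h hf (s + 1) 0)]
    simpa using hPhi
  · have e : iteratedDeriv s (fun x => ∑ ν ∈ Finset.range s, c ν * T ν x) =
        fun x => ∑ ν ∈ Finset.range s, c ν * iteratedDeriv s (T ν) x := by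
      funext x
      rw [iteratedDeriv_fun_sum fun ν hν =>
        (contDiff_const.mul (hT ν hν).1.2).contDiffAt]
      exact Finset.sum_congr rfl fun ν _ => by rw [iteratedDeriv_const_mul_field]
    have hmem : ∀ ν ∈ Finset.range s, MemLpT p (iteratedDeriv s (T ν)) := fun ν hν =>
      (hT ν hν).1.deriv_mem hp
    have hle : LpNorm p (iteratedDeriv s (fun x => ∑ ν ∈ Finset.range s, c ν * T ν x)) ≤
        2 ^ s * (((n:ℝ) * (s + 2)) ^ s * ω) := by
      rw [e]
      refine (LpNorm_sum_le hp _ fun ν hν => (hmem ν hν).const_mul hp (c ν)).trans ?_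
      have h1 : ∀ ν ∈ Finset.range s, LpNorm p (fun x => c ν * iteratedDeriv s (T ν) x) ≤
          (s.choose ν : ℝ) * (((n:ℝ) * (s + 2)) ^ s * ω) := by
        intro ν hν
        rw [LpNorm_const_mul hp _ (hmem ν hν)]
        have : |c ν| = (s.choose ν : ℝ) := by simp [c, abs_mul]
        rw [this]
        have := (hT ν hν).2
        gcongr
      refine (Finset.sum_le_sum h1).trans ?_
      rw [← Finset.sum_mul]
      have h2 : ∑ ν ∈ Finset.range s, (s.choose ν : ℝ) ≤ 2 ^ s := by
        have h3 := Nat.sum_range_choose s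
        have h4 : ∑ ν ∈ Finset.range (s + 1), (s.choose ν : ℝ) = 2 ^ s := by exact_mod_cast h3
        rw [Finset.sum_range_succ] at h4
        have : (0:ℝ) ≤ (s.choose s : ℝ) := by positivity
        linarith
      gcongr
    calc _ ≤ (1 / (n:ℝ) ^ s) * (2 ^ s * (((n:ℝ) * (s + 2)) ^ s * ω)) := by gcongr
      _ = _ := by
        rw [mul_pow]
        field_simp

lemma ellp_stek1 {p γ : ℝ} (hp : 1 ≤ p) {r : ℕ} (hr : 1 ≤ r) {X : ℕ → ℕ → ℝ} (hγ0 : 0 < γ)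
    (hγ1 : γ ≤ 1) (hX : NodesOK γ X) {n : ℕ} (hn : 1 ≤ n) {u : ℝ → ℝ} (hu : MemLpT p u) :
    ellp p n (X n) (steklov r (γ / n) u) ≤
      (2 * ∑ ν ∈ Finset.range r, ((2 * r).choose ν : ℝ) * r) / γ * LpNorm p u := by
  have hn0 : (0:ℝ) < n := by exact_mod_cast hn
  exact ellp_node hp hγ0 hγ1 hX hn hu (by positivity)
    (fun x => steklov_bound hp hr (by positivity) hu x)

lemma ellp_stek2 {p γ : ℝ} (hp : 1 ≤ p) {r s : ℕ} (hr : 1 ≤ r) (hs : 1 ≤ s) (hsr : s ≤ 2 * r)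
    {X : ℕ → ℕ → ℝ} (hγ0 : 0 < γ)
    (hγ1 : γ ≤ 1) (hX : NodesOK γ X) {n : ℕ} (hn : 1 ≤ n) {g : ℝ → ℝ} (hg : SobolevW s g) :
    ellp p n (X n) (fun x => steklov r (γ / n) g x - g x) ≤
      (2 ^ (2 * r) / γ) * ((1 / (n:ℝ) ^ s) * LpNorm p (iteratedDeriv s g)) := by
  have hn0 : (0:ℝ) < n := by exact_mod_cast hn
  refine (ellp_node hp hγ0 hγ1 hX hn (hg.deriv_mem hp) (by positivity)
    (fun x => steklov_smooth hp hr hs hsr (by positivity) hg x)).trans ?_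
  have h1 : (γ / n) ^ s ≤ 1 / (n:ℝ) ^ s := by
    rw [div_pow]
    gcongr
    exact pow_le_one₀ hγ0.le hγ1
  have h0 := LpNorm_nonneg p (iteratedDeriv s g)
  calc _ ≤ 2 ^ (2 * r) * (1 / (n:ℝ) ^ s) / γ * LpNorm p (iteratedDeriv s g) := by gcongr
    _ = _ := by ring

lemma ellp_tri {p : ℝ} (hp : 1 ≤ p) (n : ℕ) (x : ℕ → ℝ) {u a b c : ℝ → ℝ}
    (h : ∀ t, u t = a t + b t + c t) :
    ellp p n x u ≤ ellp p n x a + ellp p n x b + ellp p n x c := by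
  have e : u = fun t => (a t + b t) + c t := funext h
  rw [e]
  have h1 := ellp_add_le hp n x (fun t => a t + b t) c
  have h2 := ellp_add_le hp n x a b
  linarith

lemma LpNorm_tri {p : ℝ} (hp : 1 ≤ p) {u a b c : ℝ → ℝ} (ha : MemLpT p a) (hb : MemLpT p b)
    (hc : MemLpT p c) (h : ∀ t, u t = a t + b t + c t) :
    LpNorm p u ≤ LpNorm p a + LpNorm p b + LpNorm p c := by
  have e : u = fun t => (a t + b t) + c t := funext h
  rw [e]
  have h1 := LpNorm_add_le hp (ha.add hp hb) hc
  have h2 := LpNorm_add_le hp ha hb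
  linarith

theorem stmt12 (p γ : ℝ) (r s : ℕ) (X : ℕ → ℕ → ℝ) (φ : ℕ → ℕ → ℝ → ℝ)
    (G : ℕ → (ℝ → ℝ) → ℝ → ℝ)
    (hp : 1 ≤ p) (hr : 1 ≤ r) (hs : 1 ≤ s) (hsr : s ≤ 2 * r)
    (hγ0 : 0 < γ) (hγ1 : γ ≤ 1) (hX : NodesOK γ X) (hGform : SamplingForm p X φ G)
    (K1 : ℝ) (hK1 : 0 < K1) (hc1 : CondC1 p K1 X G) (K2 : ℝ) (hK2 : 0 < K2) (hc1' : CondC1' p K2 X G) (K3 : ℝ) (hK3 : 0 < K3) (hc2' : CondC2' p K3 s G) (K5 : ℝ) (hK5 : 0 < K5) (hc3 : CondC3 p K5 s G) :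
    ∃ c C : ℝ, 0 < c ∧ 0 < C ∧ ∀ f : ℝ → ℝ, MemLpT p f → ∀ n : ℕ, 1 ≤ n →
      c * (LpNorm p (fun x => f x - G n f x) + (1 / (n : ℝ) ^ s) * LpNorm p (iteratedDeriv s (G n f))) ≤ ellp p n (X n) (fun x => steklov r (γ / (n : ℝ)) f x - f x) + omegaMod s p f (1 / (n : ℝ)) ∧
        ellp p n (X n) (fun x => steklov r (γ / (n : ℝ)) f x - f x) + omegaMod s p f (1 / (n : ℝ)) ≤ C * (LpNorm p (fun x => f x - G n f x) + (1 / (n : ℝ) ^ s) * LpNorm p (iteratedDeriv s (G n f))) := by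
  set B : ℝ := (2 * ∑ ν ∈ Finset.range r, ((2 * r).choose ν : ℝ) * r) / γ with hB
  set E : ℝ := 2 ^ (2 * r) / γ with hE
  set Cs : ℝ := 2 ^ s * ((s:ℝ) + 2) ^ s with hCs
  set W : ℝ := 2 ^ (s + 1) * (s : ℝ) ^ s with hW
  have hB0 : 0 ≤ B := by positivity
  have hE0 : 0 < E := by positivity
  have hCs0 : 0 < Cs := by positivity
  have hW0 : 0 ≤ W := by positivity
  set M : ℝ := 1 + K3 * Cs + K1 * (1 + B + E * Cs) with hM
  have hM0 : 0 < M := by positivity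
  have hGmem : ∀ n f, MemLpT p (G n f) := by
    intro n f
    have e : G n f = fun x => ∑ k ∈ Finset.range n, f (X n k) * φ n k x :=
      funext fun x => hGform.2 n f x
    rw [e]
    exact MemLpT.sum hp _ fun k _ => (hGform.1 n k).const_mul hp _
  have hGsub : ∀ n (f g : ℝ → ℝ), G n (fun x => f x - g x) = fun x => G n f x - G n g x := by
    intro n f g
    funext x
    rw [hGform.2, hGform.2, hGform.2, ← Finset.sum_sub_distrib]
    exact Finset.sum_congr rfl fun k _ => by ring
  have h2s : (0:ℝ) < 2 ^ s := by positivity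
  refine ⟨1 / (M + K5 * (1 + 2 ^ s * M)), W + 2 ^ s + B + E + K3 / K2, by positivity,
    by positivity, ?_⟩
  intro f hf n hn
  have hn0 : (0:ℝ) < n := by exact_mod_cast hn
  have hn1 : (0:ℝ) < 1 / n := by positivity
  obtain ⟨hGs, hG5⟩ := hc3 f hf n hn
  have hGm := hGmem n f
  set A := ellp p n (X n) (fun x => steklov r (γ / (n : ℝ)) f x - f x) with hA
  set ω := omegaMod s p f (1 / (n : ℝ)) with hω
  set P := LpNorm p (fun x => f x - G n f x) with hP
  set Q := (1 / (n : ℝ) ^ s) * LpNorm p (iteratedDeriv s (G n f)) with hQ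
  have hA0 : 0 ≤ A := ellp_nonneg _ _ _ _
  have hω0 : 0 ≤ ω := omega_nonneg s f
  have hP0 : 0 ≤ P := LpNorm_nonneg _ _
  have hQ0 : 0 ≤ Q := mul_nonneg (by positivity) (LpNorm_nonneg _ _)
  constructor
  · obtain ⟨g, hg, hfg, hgD⟩ := approximant hp hs hn hf
    rw [← hω] at hfg hgD
    rw [← hCs] at hgD
    have hgm := hg.mem hp
    set D := (1 / (n:ℝ) ^ s) * LpNorm p (iteratedDeriv s g) with hD
    have hsub : MemLpT p (fun x => f x - g x) := hf.sub hp hgm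
    -- discrete norm of f - g
    have t1 : ellp p n (X n) (fun x => f x - g x) ≤ A + B * ω + E * (Cs * ω) := by
      have h1 := ellp_tri hp n (X n) (u := fun x => f x - g x)
        (a := fun x => f x - steklov r (γ / n) f x)
        (b := steklov r (γ / n) (fun x => f x - g x))
        (c := fun x => steklov r (γ / n) g x - g x)
        (fun t => by rw [steklov_sub hp r _ hf hgm]; ring)
      rw [ellp_sub_comm p n (X n) f (steklov r (γ / n) f), ← hA] at h1
      have h2 := ellp_stek1 hp hr hγ0 hγ1 hX hn hsub
      have h3 := ellp_stek2 hp hr hs hsr hγ0 hγ1 hX hn hg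
      rw [← hB] at h2
      rw [← hE, ← hD] at h3
      have h4 := mul_le_mul_of_nonneg_left hfg hB0
      have h5 := mul_le_mul_of_nonneg_left hgD hE0.le
      linarith
    have t2 : P ≤ ω + K3 * (Cs * ω) + K1 * (A + B * ω + E * (Cs * ω)) := by
      have hgf : MemLpT p (fun x => g x - f x) := hgm.sub hp hf
      have h1 := LpNorm_tri hp (u := fun x => f x - G n f x) hsub
        (hgm.sub hp (hGmem n g)) (hGmem n (fun x => g x - f x))
        (fun t => by rw [hGsub]; ring)
      have h2 := hc2' g hg n hn
      have h3 := hc1 (fun x => g x - f x) hgf n hn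
      rw [ellp_sub_comm p n (X n) g f] at h3
      have h4 := mul_le_mul_of_nonneg_left t1 hK1.le
      have h5 : K3 / (n : ℝ) ^ s * LpNorm p (iteratedDeriv s g) = K3 * D := by rw [hD]; ring
      have h6 := mul_le_mul_of_nonneg_left hgD hK3.le
      linarith
    have t3 : P ≤ M * (A + ω) := by
      refine t2.trans ?_
      have : M * (A + ω) - (ω + K3 * (Cs * ω) + K1 * (A + B * ω + E * (Cs * ω))) =
        A + K3 * Cs * A + K1 * ω + K1 * (B + E * Cs) * A := by rw [hM]; ring
      have h0 : 0 ≤ A + K3 * Cs * A + K1 * ω + K1 * (B + E * Cs) * A := by positivity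
      linarith
    have t4 : Q ≤ K5 * (1 + 2 ^ s * M) * (A + ω) := by
      have h1 := omega_le_add hp s hn1 hGm hf
      rw [LpNorm_sub_comm, ← hP, ← hω] at h1
      have h2 := mul_le_mul_of_nonneg_left h1 hK5.le
      have h3 := mul_le_mul_of_nonneg_left t3 (mul_nonneg hK5.le h2s.le)
      have h4 : 0 ≤ K5 * A := by positivity
      nlinarith
    rw [one_div, inv_mul_le_iff₀ (by positivity)]
    linarith
  · have hsub : MemLpT p (fun x => f x - G n f x) := hf.sub hp hGm
    have t1 : ω ≤ W * Q + 2 ^ s * P := by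
      have h1 := omega_le_add hp s hn1 hf hGm
      have h2 := omega_smooth hp hs hGs hn1
      rw [one_div_pow, ← hQ, ← hW] at h2
      linarith
    have t2 : A ≤ B * P + E * Q + K3 / K2 * Q := by
      have h1 := ellp_tri hp n (X n) (u := fun x => steklov r (γ / (n : ℝ)) f x - f x)
        (a := steklov r (γ / n) (fun x => f x - G n f x))
        (b := fun x => steklov r (γ / n) (G n f) x - G n f x)
        (c := fun x => G n f x - f x)
        (fun t => by rw [steklov_sub hp r _ hf hGm]; ring)
      have h2 := ellp_stek1 hp hr hγ0 hγ1 hX hn hsub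
      have h3 := ellp_stek2 hp hr hs hsr hγ0 hγ1 hX hn hGs
      rw [← hB, ← hP] at h2
      rw [← hE, ← hQ] at h3
      have h4 := hc1' (fun x => G n f x - f x) (hGm.sub hp hf) n hn
      rw [hGsub, LpNorm_sub_comm] at h4
      have h5 := hc2' (G n f) hGs n hn
      have h6 : K3 / (n : ℝ) ^ s * LpNorm p (iteratedDeriv s (G n f)) = K3 * Q := by rw [hQ]; ring
      have h7 : ellp p n (X n) (fun x => G n f x - f x) ≤ K3 / K2 * Q := by
        rw [div_mul_eq_mul_div, le_div_iff₀ hK2]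
        linarith
      linarith
    have hk : 0 < K3 / K2 := by positivity
    have : (W + 2 ^ s + B + E + K3 / K2) * (P + Q) - (W * Q + 2 ^ s * P + (B * P + E * Q + K3 / K2 * Q))
       = W * P + 2 ^ s * Q + B * Q + E * P + K3 / K2 * P := by ring
    have h0 : 0 ≤ W * P + 2 ^ s * Q + B * Q + E * P + K3 / K2 * P := by positivity
    linarith
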